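/- arXiv:2109.05962 — 4 statements merged into one kernel-verified Lean document; each statement's English description precedes it below -/
import Mathlib

section
/- Let d ≥ 2 be an integer, B > 1, and let b : [0,∞) → [0,1] be a C^∞ function supported in [1/B, B] with b(1) = 1 and Σ_{j≥0} b(u/B^j)² = 1 for all u ≥ 1. Then for every integer M > d there exists a constant C'_M > 0 (independent of j and θ) such that for all j ≥ 1 and θ ∈ (0, π], the standard needlet kernel Ψ_j(cos θ) = Σ_{ℓ ≥ 0} b(ℓ/B^j) Z_{ℓ;d}(cos θ) satisfies |Ψ_j(cos θ)| ≤ C'_M B^{jd}/(B^j θ)^{2M}. -/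
noncomputable section

/-- `η_d = (d-1)/2`. -/
def etaD (d : ℕ) : ℝ := ((d : ℝ) - 1) / 2

/-- `ω_d = 2 π^((d+1)/2) / Γ((d+1)/2)`. -/
def omegaD (d : ℕ) : ℝ :=
  2 * Real.pi ^ (((d : ℝ) + 1) / 2) / Real.Gamma (((d : ℝ) + 1) / 2)

/-- Gegenbauer polynomials `G_ℓ^{(η)}`, defined by the three-term recurrence
`G_0 = 1`, `G_1(x) = 2ηx`,
`(ℓ+1) G_{ℓ+1}(x) = 2(ℓ+η) x G_ℓ(x) − (ℓ+2η−1) G_{ℓ−1}(x)`. -/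
def gegen (η : ℝ) : ℕ → ℝ → ℝ
  | 0 => fun _ => (1 : ℝ)
  | 1 => fun x => 2 * η * x
  | (n + 2) => fun x =>
      (2 * ((n : ℝ) + 1 + η) * x * gegen η (n + 1) x
        - ((n : ℝ) + 1 + 2 * η - 1) * gegen η n x) / ((n : ℝ) + 2)

/-- The zonal kernel `Z_{ℓ;d}(t) = ((ℓ+η_d)/(η_d ω_d)) G_ℓ^{(η_d)}(t)`. -/
def Zker (d : ℕ) (ℓ : ℕ) (t : ℝ) : ℝ :=
  (((ℓ : ℝ) + etaD d) / (etaD d * omegaD d)) * gegen (etaD d) ℓ t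

namespace NeedAux

/-- forward difference -/
def dl (c : ℕ → ℝ) : ℕ → ℝ := fun l => c (l + 1) - c l

/-- backward shift, zero at the origin -/
def sh (c : ℕ → ℝ) : ℕ → ℝ
  | 0 => 0
  | (l + 1) => c l

/-- uniform symbol class -/
def PP {ι : Type} (a : ℕ) (c : ι → ℕ → ℝ) : Prop :=
  ∀ k : ℕ, ∃ C : ℝ, ∀ i l, |(dl^[k] (c i)) l| * ((l : ℝ) + 1) ^ (a + k) ≤ C

lemma dl_iter_add (k : ℕ) (c e : ℕ → ℝ) (l : ℕ) :
    (dl^[k] (fun l => c l + e l)) l = (dl^[k] c) l + (dl^[k] e) l := by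
  induction k generalizing l with
  | zero => simp
  | succ k ih =>
    simp only [Function.iterate_succ_apply'] at *
    simp only [dl, ih]; ring

lemma dl_iter_smul (k : ℕ) (s : ℝ) (c : ℕ → ℝ) (l : ℕ) :
    (dl^[k] (fun l => s * c l)) l = s * (dl^[k] c) l := by
  induction k generalizing l with
  | zero => simp
  | succ k ih =>
    simp only [Function.iterate_succ_apply'] at *
    simp only [dl, ih]; ring

lemma dl_iter_sh (k : ℕ) (c : ℕ → ℝ) (l : ℕ) :
    (dl^[k] (sh c)) (l + 1) = (dl^[k] c) l := by
  induction k generalizing l with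
  | zero => simp [sh]
  | succ k ih =>
    simp only [Function.iterate_succ_apply'] at *
    simp only [dl, ih]

lemma dl_iter_mul (k : ℕ) (s : ℝ) (c : ℕ → ℝ) (l : ℕ) :
    (dl^[k + 1] (fun l => ((l : ℝ) + s) * c l)) l =
      ((l : ℝ) + (k + 1) + s) * (dl^[k + 1] c) l + (k + 1) * (dl^[k] c) l := by
  induction k generalizing l with
  | zero => simp [dl]; ring
  | succ k ih =>
    rw [Function.iterate_succ_apply']
    rw [dl, ih, ih]
    rw [Function.iterate_succ_apply' dl (k + 1) c, Function.iterate_succ_apply' dl k c]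
    simp only [dl]
    push_cast
    ring

lemma PP.dl {ι : Type} {a : ℕ} {c : ι → ℕ → ℝ} (h : PP a c) :
    PP (a + 1) (fun i => dl (c i)) := by
  intro k
  obtain ⟨C, hC⟩ := h (k + 1)
  refine ⟨C, fun i l => ?_⟩
  have := hC i l
  rw [Function.iterate_succ_apply] at this
  rwa [show a + 1 + k = a + (k + 1) by ring]

lemma PP.add {ι : Type} {a : ℕ} {c e : ι → ℕ → ℝ} (h : PP a c) (h' : PP a e) :
    PP a (fun i l => c i l + e i l) := by
  intro k
  obtain ⟨C, hC⟩ := h k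
  obtain ⟨C', hC'⟩ := h' k
  refine ⟨C + C', fun i l => ?_⟩
  rw [dl_iter_add]
  have := abs_add_le ((NeedAux.dl^[k] (c i)) l) ((NeedAux.dl^[k] (e i)) l)
  have h1 := hC i l
  have h2 := hC' i l
  have hp : (0 : ℝ) ≤ ((l : ℝ) + 1) ^ (a + k) := by positivity
  nlinarith [mul_le_mul_of_nonneg_right this hp]

lemma PP.smul {ι : Type} {a : ℕ} {c : ι → ℕ → ℝ} (h : PP a c) (s : ℝ) :
    PP a (fun i l => s * c i l) := by
  intro k
  obtain ⟨C, hC⟩ := h k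
  refine ⟨|s| * C, fun i l => ?_⟩
  rw [dl_iter_smul, abs_mul, mul_assoc]
  exact mul_le_mul_of_nonneg_left (hC i l) (abs_nonneg s)

lemma PP.sh {ι : Type} {a : ℕ} {c : ι → ℕ → ℝ} (h : PP a c) :
    PP a (fun i => sh (c i)) := by
  have h0 : ∀ k : ℕ, ∃ C : ℝ, ∀ i, |(NeedAux.dl^[k] (NeedAux.sh (c i))) 0| ≤ C := by
    intro k
    induction k with
    | zero => exact ⟨0, fun i => by simp [NeedAux.sh]⟩
    | succ k ih =>
      obtain ⟨C, hC⟩ := ih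
      obtain ⟨C', hC'⟩ := h k
      refine ⟨C' + C, fun i => ?_⟩
      rw [Function.iterate_succ_apply', NeedAux.dl, dl_iter_sh]
      have h1 := hC' i 0
      simp at h1
      exact (abs_sub _ _).trans (add_le_add h1 (hC i))
  intro k
  obtain ⟨C, hC⟩ := h0 k
  obtain ⟨C', hC'⟩ := h k
  refine ⟨max C (2 ^ (a + k) * C'), fun i l => ?_⟩
  cases l with
  | zero => simpa using Or.inl (hC i)
  | succ l =>
    rw [dl_iter_sh]
    refine le_trans ?_ (le_max_right _ _)
    have h1 : (((l + 1 : ℕ) : ℝ) + 1) ^ (a + k) ≤ 2 ^ (a + k) * ((l : ℝ) + 1) ^ (a + k) := by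
      rw [← mul_pow]
      apply pow_le_pow_left₀ (by positivity)
      push_cast
      have : (0 : ℝ) ≤ l := by positivity
      linarith
    calc _ ≤ |(NeedAux.dl^[k] (c i)) l| * (2 ^ (a + k) * ((l : ℝ) + 1) ^ (a + k)) :=
          mul_le_mul_of_nonneg_left h1 (abs_nonneg _)
      _ = 2 ^ (a + k) * (|(NeedAux.dl^[k] (c i)) l| * ((l : ℝ) + 1) ^ (a + k)) := by ring
      _ ≤ _ := mul_le_mul_of_nonneg_left (hC' i l) (by positivity)

lemma PP.mul {ι : Type} {a : ℕ} {c : ι → ℕ → ℝ} (h : PP (a + 1) c) :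
    PP a (fun i l => (l : ℝ) * c i l) := by
  intro k
  cases k with
  | zero =>
    obtain ⟨C, hC⟩ := h 0
    refine ⟨C, fun i l => le_trans ?_ (hC i l)⟩
    simp only [Function.iterate_zero, id, abs_mul, add_zero, pow_succ]
    have : |(l : ℝ)| ≤ (l : ℝ) + 1 := by rw [abs_of_nonneg (by positivity)]; linarith
    have hp : (0 : ℝ) ≤ |c i l| * ((l : ℝ) + 1) ^ a := by positivity
    nlinarith [mul_le_mul_of_nonneg_left this hp]
  | succ k =>
    obtain ⟨C, hC⟩ := h (k + 1)
    obtain ⟨C', hC'⟩ := h k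
    refine ⟨(k + 1) * C + (k + 1) * C', fun i l => ?_⟩
    have e := dl_iter_mul k 0 (c i) l
    simp only [add_zero] at e
    rw [e]
    have h1 := hC i l
    have h2 := hC' i l
    set X := (NeedAux.dl^[k + 1] (c i)) l
    set Y := (NeedAux.dl^[k] (c i)) l
    have hl : (0 : ℝ) ≤ l := by positivity
    have hk : (0 : ℝ) ≤ k := by positivity
    have t : |((l : ℝ) + (k + 1)) * X + (k + 1) * Y| ≤
        ((k + 1) * ((l : ℝ) + 1)) * |X| + (k + 1) * |Y| := by
      refine (abs_add_le _ _).trans ?_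
      rw [abs_mul, abs_mul, abs_of_nonneg (by positivity : (0 : ℝ) ≤ (l : ℝ) + (k + 1)),
        abs_of_nonneg (by positivity : (0 : ℝ) ≤ (k : ℝ) + 1)]
      gcongr
      nlinarith
    calc _ ≤ (((k + 1) * ((l : ℝ) + 1)) * |X| + (k + 1) * |Y|) * ((l : ℝ) + 1) ^ (a + (k + 1)) := by
          gcongr
      _ = (k + 1) * (|X| * ((l : ℝ) + 1) ^ (a + 1 + (k + 1)))
          + (k + 1) * (|Y| * ((l : ℝ) + 1) ^ (a + 1 + k)) := by ring
      _ ≤ _ := by gcongr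

lemma PP.div {ι : Type} {a : ℕ} {c : ι → ℕ → ℝ} (h : PP a c) (s : ℝ) (hs : 1 / 2 ≤ s) :
    PP (a + 1) (fun i l => c i l / ((l : ℝ) + s)) := by
  have hpos : ∀ l : ℕ, (0 : ℝ) < (l : ℝ) + s := fun l => by
    have : (0 : ℝ) ≤ l := by positivity
    linarith
  intro k
  induction k with
  | zero =>
    obtain ⟨C, hC⟩ := h 0
    refine ⟨2 * C, fun i l => ?_⟩
    have h1 := hC i l
    simp only [Function.iterate_zero, id, add_zero, pow_succ] at h1 ⊢
    have hl : (0 : ℝ) ≤ l := by positivity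
    rw [abs_div, abs_of_pos (hpos l), div_mul_eq_mul_div, div_le_iff₀ (hpos l)]
    have : (l : ℝ) + 1 ≤ 2 * (l + s) := by linarith
    have hp : (0 : ℝ) ≤ |c i l| * ((l : ℝ) + 1) ^ a := by positivity
    nlinarith [mul_le_mul_of_nonneg_left this hp, hpos l,
      mul_le_mul_of_nonneg_right h1 (hpos l).le]
  | succ k ih =>
    obtain ⟨C, hC⟩ := ih
    obtain ⟨C', hC'⟩ := h (k + 1)
    refine ⟨2 * (C' + (k + 1) * C), fun i l => ?_⟩
    have e := dl_iter_mul k s (fun l => c i l / ((l : ℝ) + s)) l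
    have e2 : (fun l : ℕ => ((l : ℝ) + s) * (c i l / ((l : ℝ) + s))) = c i := by
      funext l
      field_simp [(hpos l).ne']
    rw [e2] at e
    have h1 := hC' i l
    have h2 := hC i l
    set X := (NeedAux.dl^[k + 1] (fun l => c i l / ((l : ℝ) + s))) l
    set Y := (NeedAux.dl^[k] (fun l => c i l / ((l : ℝ) + s))) l
    set Z := (NeedAux.dl^[k + 1] (c i)) l
    have hl : (0 : ℝ) ≤ l := by positivity
    have hk : (0 : ℝ) ≤ k := by positivity
    have t : ((l : ℝ) + 1) * |X| ≤ 2 * (|Z| + (k + 1) * |Y|) := by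
      have : ((l : ℝ) + (k + 1) + s) * X = Z - (k + 1) * Y := by linarith
      have h3 : ((l : ℝ) + (k + 1) + s) * |X| = |Z - (k + 1) * Y| := by
        rw [← this, abs_mul, abs_of_pos (by linarith : (0 : ℝ) < (l : ℝ) + (k + 1) + s)]
      have h4 : |Z - (k + 1) * Y| ≤ |Z| + (k + 1) * |Y| := by
        refine (abs_sub _ _).trans ?_
        rw [abs_mul, abs_of_nonneg (by positivity : (0 : ℝ) ≤ (k : ℝ) + 1)]
      have h5 : 0 ≤ |X| := abs_nonneg _
      nlinarith
    calc |X| * ((l : ℝ) + 1) ^ (a + 1 + (k + 1))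
        = (((l : ℝ) + 1) * |X|) * ((l : ℝ) + 1) ^ (a + (k + 1)) := by ring
      _ ≤ (2 * (|Z| + (k + 1) * |Y|)) * ((l : ℝ) + 1) ^ (a + (k + 1)) := by gcongr
      _ = 2 * (|Z| * ((l : ℝ) + 1) ^ (a + (k + 1))
          + (k + 1) * (|Y| * ((l : ℝ) + 1) ^ (a + 1 + k))) := by ring
      _ ≤ _ := by gcongr

/-- the operator representing multiplication by `1 - x` -/
def DD (s : ℝ) (c : ℕ → ℝ) : ℕ → ℝ := fun l =>
  ((-1 / 2) * (dl (fun l => (l : ℝ) * sh (dl c) l) l + (2 * s - 1) * dl c l)) / ((l : ℝ) + s)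

lemma PP.DD {ι : Type} {a : ℕ} {c : ι → ℕ → ℝ} (h : PP a c) (s : ℝ) (hs : 1 / 2 ≤ s) :
    PP (a + 2) (fun i => DD s (c i)) :=
  (((h.dl.sh.mul.dl).add (h.dl.smul (2 * s - 1))).smul (-1 / 2)).div s hs

lemma PP.iter {ι : Type} {c : ι → ℕ → ℝ} (h : PP 0 c) (s : ℝ) (hs : 1 / 2 ≤ s) (m : ℕ) :
    PP (2 * m) (fun i => (NeedAux.DD s)^[m] (c i)) := by
  induction m with
  | zero => exact h
  | succ m ih =>
    simp only [Function.iterate_succ_apply']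
    exact ih.DD s hs

lemma DD_lower (s : ℝ) (c : ℕ → ℝ) (L : ℝ) (h : ∀ l : ℕ, (l : ℝ) < L → c l = 0) :
    ∀ l : ℕ, (l : ℝ) + 1 < L → DD s c l = 0 := by
  intro l hl
  have h1 : c l = 0 := h l (by linarith)
  have h2 : c (l + 1) = 0 := h (l + 1) (by push_cast; linarith)
  cases l with
  | zero => simp at h2; simp [DD, dl, sh, h1, h2]
  | succ l =>
    have h3 : c l = 0 := h l (by push_cast at hl; linarith)
    simp [DD, dl, sh, h1, h2, h3]

lemma DD_upper (s : ℝ) (c : ℕ → ℝ) (L : ℝ) (h : ∀ l : ℕ, L < (l : ℝ) → c l = 0) (hL : 0 ≤ L) :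
    ∀ l : ℕ, L + 1 < (l : ℝ) → DD s c l = 0 := by
  intro l hl
  have h1 : c l = 0 := h l (by linarith)
  have h2 : c (l + 1) = 0 := h (l + 1) (by push_cast; linarith)
  cases l with
  | zero => simp at hl; linarith
  | succ l =>
    have h3 : c l = 0 := h l (by push_cast at hl; linarith)
    simp [DD, dl, sh, h1, h2, h3]

lemma DD_iter_lower (s : ℝ) (c : ℕ → ℝ) (L : ℝ) (h : ∀ l : ℕ, (l : ℝ) < L → c l = 0) (m : ℕ) :
    ∀ l : ℕ, (l : ℝ) + m < L → ((DD s)^[m] c) l = 0 := by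
  induction m with
  | zero => simpa using h
  | succ m ih =>
    intro l hl
    rw [Function.iterate_succ_apply']
    apply DD_lower s _ (L - m) (fun l hl => ih l (by linarith)) l
    push_cast at hl; linarith

lemma DD_iter_upper (s : ℝ) (c : ℕ → ℝ) (L : ℝ) (h : ∀ l : ℕ, L < (l : ℝ) → c l = 0) (hL : 0 ≤ L)
    (m : ℕ) : ∀ l : ℕ, L + m < (l : ℝ) → ((DD s)^[m] c) l = 0 := by
  induction m with
  | zero => simpa using h
  | succ m ih =>
    intro l hl
    rw [Function.iterate_succ_apply']
    apply DD_upper s _ (L + m) ih (by positivity) l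
    push_cast at hl; linarith

lemma sum_DD_aux (s : ℝ) (hs : 1 / 2 ≤ s) (c : ℕ → ℝ) (x : ℝ) (n : ℕ) :
    (1 - x) * ∑ l ∈ Finset.range (n + 1), c l * ((l : ℝ) + s) * gegen s l x =
      ∑ l ∈ Finset.range (n + 1), DD s c l * ((l : ℝ) + s) * gegen s l x
      - (1 / 2) * (n + 1) * c n * gegen s (n + 1) x
      + (1 / 2) * (n + 2 * s) * c (n + 1) * gegen s n x := by
  have hpos : ∀ l : ℕ, (0 : ℝ) < (l : ℝ) + s := fun l => by
    have : (0 : ℝ) ≤ l := by positivity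
    linarith
  have hD : ∀ l, DD s c l * ((l : ℝ) + s) =
      (-1 / 2) * (dl (fun l => (l : ℝ) * sh (dl c) l) l + (2 * s - 1) * dl c l) := by
    intro l
    rw [DD, div_mul_cancel₀ _ (hpos l).ne']
  induction n with
  | zero =>
    simp [hD, dl, sh, gegen]
    ring
  | succ n ih =>
    rw [Finset.sum_range_succ, mul_add, ih, Finset.sum_range_succ _ (n + 1), hD]
    have hr : ((n : ℝ) + 2) * gegen s (n + 2) x = 2 * ((n : ℝ) + 1 + s) * x * gegen s (n + 1) x
        - ((n : ℝ) + 1 + 2 * s - 1) * gegen s n x := by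
      rw [gegen]
      field_simp
    simp only [dl, sh]
    push_cast
    linear_combination (1 / 2) * c (n + 1) * hr

lemma sum_DD (s : ℝ) (hs : 1 / 2 ≤ s) (c : ℕ → ℝ) (x : ℝ) (n : ℕ) (h : ∀ l, n ≤ l → c l = 0) :
    (1 - x) * ∑ l ∈ Finset.range (n + 1), c l * ((l : ℝ) + s) * gegen s l x =
      ∑ l ∈ Finset.range (n + 1), DD s c l * ((l : ℝ) + s) * gegen s l x := by
  rw [sum_DD_aux s hs, h n le_rfl, h (n + 1) (by omega)]
  ring

lemma sum_DD_iter (s : ℝ) (hs : 1 / 2 ≤ s) (c : ℕ → ℝ) (x : ℝ) (n m : ℕ)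
    (h : ∀ k, k < m → ∀ l, n ≤ l → ((DD s)^[k] c) l = 0) :
    (1 - x) ^ m * ∑ l ∈ Finset.range (n + 1), c l * ((l : ℝ) + s) * gegen s l x =
      ∑ l ∈ Finset.range (n + 1), ((DD s)^[m] c) l * ((l : ℝ) + s) * gegen s l x := by
  induction m with
  | zero => simp
  | succ m ih =>
    rw [pow_succ', mul_assoc, ih (fun k hk => h k (by omega)), sum_DD s hs _ x n (h m (by omega)),
      Function.iterate_succ_apply']

end NeedAux
namespace NeedAux

/-- coefficients of `(1 - t)^(-s)` -/
def ak (s : ℝ) : ℕ → ℝ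
  | 0 => 1
  | (k + 1) => (s + k) / (k + 1) * ak s k

lemma ak_nonneg (s : ℝ) (hs : 0 ≤ s) (k : ℕ) : 0 ≤ ak s k := by
  induction k with
  | zero => simp [ak]
  | succ k ih => rw [ak]; positivity

open PowerSeries in
/-- the power series of `(1 - z t)^(-s)` -/
def As (s : ℝ) (z : ℂ) : PowerSeries ℂ := PowerSeries.mk (fun k => (ak s k : ℂ) * z ^ k)

open PowerSeries in
lemma As_deriv (s : ℝ) (z : ℂ) :
    (1 - C z * X) * derivative ℂ (As s z) = C (s : ℂ) * C z * As s z := by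
  ext n
  rw [sub_mul, one_mul, mul_assoc, mul_assoc, map_sub, coeff_C_mul, coeff_C_mul, coeff_C_mul,
    coeff_derivative]
  have hX : coeff n (X * derivative ℂ (As s z)) = n * coeff n (As s z) := by
    cases n with
    | zero => simp
    | succ n => rw [coeff_succ_X_mul, coeff_derivative]; push_cast; ring
  rw [hX]
  simp only [As, coeff_mk, ak]
  push_cast
  have : ((n : ℂ) + 1) ≠ 0 := by exact_mod_cast Nat.succ_ne_zero n
  field_simp
  ring

/-- convolution form of the Gegenbauer polynomials -/
def Hc (s : ℝ) (z w : ℂ) (n : ℕ) : ℂ := PowerSeries.coeff n (As s z * As s w)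

open PowerSeries in
lemma Hc_rec (s : ℝ) (z w : ℂ) (hzw : z * w = 1) (n : ℕ) :
    ((n : ℂ) + 2) * Hc s z w (n + 2) =
      ((n : ℂ) + 1 + s) * (z + w) * Hc s z w (n + 1) - ((n : ℂ) + 2 * s) * Hc s z w n := by
  have h1 := As_deriv s z
  have h2 := As_deriv s w
  have hP : derivative ℂ (As s z * As s w) = As s z * derivative ℂ (As s w) +
      As s w * derivative ℂ (As s z) := by
    rw [Derivation.leibniz]; simp [smul_eq_mul]
  have hC : (C z : PowerSeries ℂ) * C w = 1 := by rw [← map_mul, hzw, map_one]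
  have key : derivative ℂ (As s z * As s w) - C (z + w) * (X * derivative ℂ (As s z * As s w))
      + X * (X * derivative ℂ (As s z * As s w)) =
      C (s * (z + w)) * (As s z * As s w) - C (2 * (s : ℂ)) * (X * (As s z * As s w)) := by
    rw [hP]
    have h2' : (C (2 : ℂ) : PowerSeries ℂ) = 2 := map_ofNat C 2
    simp only [map_add, map_mul, h2']
    linear_combination (1 - C w * X) * As s w * h1 + (1 - C z * X) * As s z * h2
      - (X * X * (As s z * derivative ℂ (As s w) +
      As s w * derivative ℂ (As s z)) + 2 * C (s : ℂ) * X * As s z * As s w) * hC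
  obtain ⟨q, hq⟩ : ∃ q, q = z + w := ⟨_, rfl⟩
  rw [← hq] at key ⊢
  have := congrArg (coeff (n + 1)) key
  simp only [map_sub, map_add, coeff_C_mul, coeff_succ_X_mul, coeff_derivative] at this
  have hX : coeff n (X * derivative ℂ (As s z * As s w)) = n * Hc s z w n := by
    cases n with
    | zero => simp
    | succ n => rw [coeff_succ_X_mul, coeff_derivative, Hc]; push_cast; ring
  rw [hX] at this
  simp only [Hc] at *
  push_cast at this
  linear_combination this

lemma gegen_eq_Hc (s : ℝ) (z w : ℂ) (hzw : z * w = 1) (x : ℝ) (hx : z + w = 2 * (x : ℂ)) (n : ℕ) :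
    (gegen s n x : ℂ) = Hc s z w n := by
  induction n using Nat.strong_induction_on with
  | _ n ih =>
    match n with
    | 0 => simp [gegen, Hc, As, ak, PowerSeries.coeff_mul]
    | 1 =>
      have : Hc s z w 1 = s * (z + w) := by
        simp [Hc, As, ak, PowerSeries.coeff_mul, Finset.Nat.antidiagonal_succ]
        ring
      rw [this, hx]
      simp [gegen]
      ring
    | (n + 2) =>
      have h1 := ih (n + 1) (by omega)
      have h0 := ih n (by omega)
      have hr := Hc_rec s z w hzw n
      rw [← h1, ← h0, hx] at hr
      have hn : ((n : ℂ) + 2) ≠ 0 := by exact_mod_cast Nat.succ_ne_zero (n + 1)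
      apply mul_left_cancel₀ hn
      rw [hr, gegen]
      push_cast
      field_simp
      ring

lemma gegen_abs_le (s : ℝ) (hs : 0 ≤ s) (θ : ℝ) (n : ℕ) :
    |gegen s n (Real.cos θ)| ≤ gegen s n 1 := by
  have h1 : gegen s n 1 = ∑ p ∈ Finset.HasAntidiagonal.antidiagonal n, ak s p.1 * ak s p.2 := by
    have := gegen_eq_Hc s 1 1 (by ring) 1 (by push_cast; ring) n
    have h2 : Hc s 1 1 n = ((∑ p ∈ Finset.HasAntidiagonal.antidiagonal n, ak s p.1 * ak s p.2 : ℝ) : ℂ) := by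
      simp [Hc, As, PowerSeries.coeff_mul]
    rw [h2] at this
    exact_mod_cast this
  have h2 := gegen_eq_Hc s (Complex.exp (θ * Complex.I)) (Complex.exp (-θ * Complex.I))
    (by rw [← Complex.exp_add]; simp) (Real.cos θ)
    (by rw [Complex.ofReal_cos, Complex.two_cos]) n
  have h3 : |gegen s n (Real.cos θ)| = ‖(gegen s n (Real.cos θ) : ℂ)‖ := by
    rw [Complex.norm_real, Real.norm_eq_abs]
  rw [h3, h2, h1, Hc, PowerSeries.coeff_mul]
  refine (norm_sum_le _ _).trans (Finset.sum_le_sum fun p _ => ?_)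
  have e1 : ‖Complex.exp (θ * Complex.I)‖ = 1 := Complex.norm_exp_ofReal_mul_I θ
  have e2 : ‖Complex.exp (-θ * Complex.I)‖ = 1 := by
    have := Complex.norm_exp_ofReal_mul_I (-θ)
    simpa using this
  simp only [As, PowerSeries.coeff_mk, norm_mul, norm_pow, e1, e2, one_pow, mul_one,
    Complex.norm_real, Real.norm_eq_abs]
  rw [abs_of_nonneg (ak_nonneg s hs _), abs_of_nonneg (ak_nonneg s hs _)]

lemma gegen_one_rec (s : ℝ) (n : ℕ) :
    ((n : ℝ) + 1) * gegen s (n + 1) 1 = ((n : ℝ) + 2 * s) * gegen s n 1 := by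
  induction n with
  | zero => simp [gegen]
  | succ n ih =>
    have e : ((n : ℝ) + 2) * gegen s (n + 2) 1 = 2 * ((n : ℝ) + 1 + s) * 1 * gegen s (n + 1) 1
        - ((n : ℝ) + 1 + 2 * s - 1) * gegen s n 1 := by
      rw [gegen]
      field_simp
    push_cast
    linear_combination e + ih

lemma gegen_one_le (d : ℕ) (hd : 2 ≤ d) (n : ℕ) :
    gegen (etaD d) n 1 ≤ ((n : ℝ) + 1) ^ (d - 2) := by
  obtain ⟨e, rfl⟩ := Nat.exists_eq_add_of_le hd
  simp only [Nat.add_sub_cancel_left]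
  induction n with
  | zero => simp [gegen]
  | succ n ih =>
    have hr := gegen_one_rec (etaD (2 + e)) n
    have h2 : 2 * etaD (2 + e) = 1 + e := by simp [etaD]; ring
    rw [h2] at hr
    have hn : (0 : ℝ) < (n : ℝ) + 1 := by positivity
    have hb := one_add_mul_le_pow (a := 1 / ((n : ℝ) + 1))
      (by have : 0 < 1 / ((n : ℝ) + 1) := by positivity
          linarith) e
    have h3 : gegen (etaD (2 + e)) (n + 1) 1 =
        (1 + e * (1 / ((n : ℝ) + 1))) * gegen (etaD (2 + e)) n 1 := by
      apply mul_left_cancel₀ hn.ne'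
      rw [hr]
      field_simp
      ring
    rw [h3]
    calc (1 + e * (1 / ((n : ℝ) + 1))) * gegen (etaD (2 + e)) n 1
        ≤ (1 + e * (1 / ((n : ℝ) + 1))) * ((n : ℝ) + 1) ^ e := by gcongr
      _ ≤ (1 + 1 / ((n : ℝ) + 1)) ^ e * ((n : ℝ) + 1) ^ e := by gcongr
      _ = (((n + 1 : ℕ) : ℝ) + 1) ^ e := by
        rw [← mul_pow]
        congr 1
        push_cast
        field_simp

end NeedAux
namespace NeedAux

lemma dl_smooth (k : ℕ) (f : ℝ → ℝ) (hf : ContDiff ℝ (⊤ : ℕ∞) f) (A h : ℝ) (hh : 0 ≤ h)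
    (hA : ∀ x, |iteratedDeriv k f x| ≤ A) (l : ℕ) :
    |(dl^[k] (fun l : ℕ => f (l * h))) l| ≤ A * h ^ k := by
  induction k generalizing f A l with
  | zero => simpa using hA (l * h)
  | succ k ih =>
    rw [Function.iterate_succ_apply]
    have e : dl (fun l : ℕ => f (l * h)) = fun l : ℕ => (fun x => f (x + h) - f x) (l * h) := by
      funext l
      simp only [dl]
      push_cast
      ring_nf
    rw [e]
    have hfs : ContDiff ℝ (⊤ : ℕ∞) (fun x => f (x + h)) := hf.comp (contDiff_id.add contDiff_const)
    have hk : ((k : ℕ) : WithTop ℕ∞) ≤ ((⊤ : ℕ∞) : WithTop ℕ∞) := by exact_mod_cast le_top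
    have := ih (fun x => f (x + h) - f x) (hfs.sub hf) (A * h) ?_ l
    · calc _ ≤ _ := this
        _ = _ := by ring
    · intro x
      rw [iteratedDeriv_fun_sub (hfs.of_le hk).contDiffAt (hf.of_le hk).contDiffAt,
        iteratedDeriv_comp_add_const]
      have hd : Differentiable ℝ (iteratedDeriv k f) :=
        hf.differentiable_iteratedDeriv k (by exact_mod_cast WithTop.coe_lt_top k)
      have := Convex.norm_image_sub_le_of_norm_deriv_le (f := iteratedDeriv k f) (C := A)
        (s := Set.univ) (x := x) (y := x + h) (fun y _ => hd y)
        (fun y _ => by rw [← iteratedDeriv_succ]; exact hA y) convex_univ trivial trivial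
      simpa [abs_of_nonneg hh] using this

lemma dl_iter_zero (k : ℕ) (c : ℕ → ℝ) (L : ℝ) (h : ∀ l : ℕ, L < (l : ℝ) → c l = 0) :
    ∀ l : ℕ, L < (l : ℝ) → (dl^[k] c) l = 0 := by
  induction k with
  | zero => simpa using h
  | succ k ih =>
    intro l hl
    rw [Function.iterate_succ_apply', dl, ih l hl, ih (l + 1) (by push_cast; linarith), sub_zero]

lemma PP_base (B : ℝ) (hB : 1 < B) (b : ℝ → ℝ) (hbC : ContDiff ℝ (⊤ : ℕ∞) b)
    (hbsupp : ∀ u : ℝ, u ∉ Set.Icc (1 / B) B → b u = 0) :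
    PP 0 (fun (j : ℕ) (l : ℕ) => b ((l : ℝ) / B ^ j)) := by
  intro k
  have hcs : HasCompactSupport (iteratedDeriv k b) := by
    rw [iteratedDeriv_eq_iterate]
    have h0 : HasCompactSupport b := HasCompactSupport.intro isCompact_Icc hbsupp
    clear hbsupp hbC
    induction k with
    | zero => exact h0
    | succ k ih => rw [Function.iterate_succ_apply']; exact ih.deriv
  obtain ⟨A, hA⟩ := hcs.exists_bound_of_continuous
    (hbC.continuous_iteratedDeriv k (by exact_mod_cast le_top))
  have hA0 : 0 ≤ A := (norm_nonneg _).trans (hA 0)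
  refine ⟨A * (B + 1) ^ k, fun j l => ?_⟩
  have hS : 1 ≤ B ^ j := one_le_pow₀ hB.le
  have hS0 : 0 < B ^ j := by linarith
  have hz := dl_iter_zero k (fun l : ℕ => b ((l : ℝ) / B ^ j)) (B * B ^ j) (fun l hl => by
    apply hbsupp
    rw [Set.mem_Icc, not_and_or]
    right
    rw [not_le, lt_div_iff₀ hS0]
    exact hl)
  by_cases hl : B * B ^ j < (l : ℝ)
  · rw [hz l hl, abs_zero, zero_mul]; positivity
  · push Not at hl
    have h1 := dl_smooth k b hbC A (1 / B ^ j) (by positivity) hA l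
    simp only [mul_one_div] at h1
    have h2 : (l : ℝ) + 1 ≤ (B + 1) * B ^ j := by linarith
    rw [zero_add]
    calc _ ≤ (A * (1 / B ^ j) ^ k) * ((B + 1) * B ^ j) ^ k := by gcongr
      _ = A * (B + 1) ^ k * ((1 / B ^ j) * B ^ j) ^ k := by
        simp only [mul_pow]; ring
      _ = _ := by rw [one_div, inv_mul_cancel₀ hS0.ne', one_pow, mul_one]

end NeedAux
/-- **Localization of standard needlets.**
For `B > 1` and a standard needlet weight function `b` (smooth, `[0,1]`-valued,
supported in `[1/B, B]`, `b(1) = 1`, partition of unity), for every integer `M > d`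
there is `C'_M > 0` with `|Ψ_j(cos θ)| ≤ C'_M B^{jd}/(B^j θ)^{2M}`. -/
theorem standard_needlet_localization
    (d : ℕ) (hd : 2 ≤ d) (B : ℝ) (hB : 1 < B) (b : ℝ → ℝ)
    (hbC : ContDiff ℝ (⊤ : ℕ∞) b)
    (hb01 : ∀ u : ℝ, 0 ≤ u → b u ∈ Set.Icc (0 : ℝ) 1)
    (hbsupp : ∀ u : ℝ, u ∉ Set.Icc (1 / B) B → b u = 0)
    (hb1 : b 1 = 1)
    (hbpart : ∀ u : ℝ, 1 ≤ u → ∑' j : ℕ, (b (u / B ^ j)) ^ 2 = 1) :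
    ∀ M : ℕ, d < M → ∃ C : ℝ, 0 < C ∧
      ∀ j : ℕ, 1 ≤ j → ∀ θ : ℝ, 0 < θ → θ ≤ Real.pi →
        |∑' ℓ : ℕ, b ((ℓ : ℝ) / B ^ j) * Zker d ℓ (Real.cos θ)| ≤
          C * B ^ (j * d) / (B ^ j * θ) ^ (2 * M) := by
  intro M hM
  have hs : 1 / 2 ≤ etaD d := by
    have : (2 : ℝ) ≤ d := by exact_mod_cast hd
    simp only [etaD]; linarith
  have hsd : etaD d ≤ d := by
    have : (2 : ℝ) ≤ d := by exact_mod_cast hd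
    simp only [etaD]; linarith
  obtain ⟨K, hK⟩ := ((NeedAux.PP_base B hB b hbC hbsupp).iter (etaD d) hs M) 0
  have hK0 : 0 ≤ K := le_trans (by positivity) (hK 0 0)
  set s := etaD d with hsdef
  set R : ℝ := B * (M + 1) with hR
  have hR0 : 0 < R := by positivity
  set Q : ℝ := B + M + 2 with hQ
  have hQ0 : 0 < Q := by positivity
  set W : ℝ := |1 / (s * omegaD d)| with hW
  refine ⟨W * (K * R ^ (2 * M) * d * Q ^ d) * (Real.pi ^ 2 / 2) ^ M + 1, by positivity, ?_⟩
  intro j hj θ hθ hθπ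
  set S : ℝ := B ^ j with hSdef
  have hS : 1 ≤ S := one_le_pow₀ hB.le
  have hS0 : 0 < S := by linarith
  set x := Real.cos θ with hx
  set c : ℕ → ℝ := fun l => b ((l : ℝ) / S) with hc
  set n : ℕ := ⌊B * S⌋₊ + M + 1 with hn
  have hup : ∀ l : ℕ, B * S < (l : ℝ) → c l = 0 := fun l hl => by
    apply hbsupp
    rw [Set.mem_Icc, not_and_or]
    right
    rw [not_le, lt_div_iff₀ hS0]
    exact hl
  have hlow : ∀ l : ℕ, (l : ℝ) < S / B → c l = 0 := fun l hl => by
    apply hbsupp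
    rw [Set.mem_Icc, not_and_or]
    left
    rw [not_le, div_lt_div_iff₀ hS0 (by positivity)]
    rw [lt_div_iff₀ (by positivity)] at hl
    linarith
  have hnl : ∀ l : ℕ, n ≤ l → B * S + M < (l : ℝ) := fun l hl => by
    have h1 : (n : ℝ) ≤ l := by exact_mod_cast hl
    have h2 := Nat.lt_floor_add_one (B * S)
    rw [hn] at h1
    push_cast at h1
    linarith
  have hnQ : ((n + 1 : ℕ) : ℝ) ≤ Q * S := by
    have h2 := Nat.floor_le (show 0 ≤ B * S by positivity)
    have hM0 : (0 : ℝ) ≤ M := by positivity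
    rw [hn, hQ]
    push_cast
    nlinarith
  -- the kernel as a finite sum
  have hsum : ∑' l : ℕ, b ((l : ℝ) / S) * Zker d l x =
      (1 / (s * omegaD d)) * ∑ l ∈ Finset.range (n + 1), c l * ((l : ℝ) + s) * gegen s l x := by
    rw [tsum_eq_sum (s := Finset.range (n + 1)), Finset.mul_sum]
    · refine Finset.sum_congr rfl fun l _ => ?_
      simp only [Zker, hc, ← hsdef]
      ring
    · intro l hl
      have : c l = 0 := hup l (by
        have := hnl l (by simp at hl; omega)
        have hM0 : (0 : ℝ) ≤ M := by positivity
        linarith)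
      simp only [hc] at this
      rw [this, zero_mul]
  have hiter := NeedAux.sum_DD_iter s hs c x n M (fun k hk l hl =>
    NeedAux.DD_iter_upper s c (B * S) hup (by positivity) k l (by
      have h1 := hnl l hl
      have h2 : (k : ℝ) ≤ M := by exact_mod_cast hk.le
      linarith))
  set T := ∑ l ∈ Finset.range (n + 1), c l * ((l : ℝ) + s) * gegen s l x with hT
  -- pointwise bound
  have hterm : ∀ l ∈ Finset.range (n + 1),
      |((NeedAux.DD s)^[M] c) l * ((l : ℝ) + s) * gegen s l x| ≤
        K * R ^ (2 * M) / S ^ (2 * M) * (d * (Q * S) ^ (d - 1)) := by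
    intro l hl
    have hl0 : (0 : ℝ) ≤ l := by positivity
    have hd2 : (2 : ℝ) ≤ d := by exact_mod_cast hd
    by_cases hlS : (l : ℝ) + M < S / B
    · rw [NeedAux.DD_iter_lower s c (S / B) hlow M l hlS, zero_mul, zero_mul, abs_zero]
      positivity
    · push Not at hlS
      have h1 : |((NeedAux.DD s)^[M] c) l| ≤ K * R ^ (2 * M) / S ^ (2 * M) := by
        have h2 := hK j l
        simp only [Function.iterate_zero, id, add_zero] at h2
        have h3 : S ≤ R * ((l : ℝ) + 1) := by
          rw [div_le_iff₀ (by positivity)] at hlS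
          have hM0 : (0 : ℝ) ≤ M := by positivity
          have : (l : ℝ) + M ≤ (M + 1) * (l + 1) := by nlinarith
          calc S ≤ ((l : ℝ) + M) * B := hlS
            _ ≤ ((M + 1) * (l + 1)) * B := by gcongr
            _ = _ := by rw [hR]; ring
        rw [le_div_iff₀ (by positivity)]
        calc |((NeedAux.DD s)^[M] c) l| * S ^ (2 * M)
            ≤ |((NeedAux.DD s)^[M] c) l| * (R * ((l : ℝ) + 1)) ^ (2 * M) := by gcongr
          _ = (|((NeedAux.DD s)^[M] c) l| * ((l : ℝ) + 1) ^ (2 * M)) * R ^ (2 * M) := by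
            rw [mul_pow]; ring
          _ ≤ K * R ^ (2 * M) := by gcongr
      have h4 : |gegen s l x| ≤ ((l : ℝ) + 1) ^ (d - 2) :=
        (NeedAux.gegen_abs_le s (by linarith) θ l).trans (NeedAux.gegen_one_le d hd l)
      have h5 : |(l : ℝ) + s| ≤ d * ((l : ℝ) + 1) := by
        rw [abs_of_nonneg (by linarith)]
        nlinarith
      have h6 : (l : ℝ) + 1 ≤ Q * S := by
        refine le_trans ?_ hnQ
        have := Finset.mem_range.1 hl
        exact_mod_cast this
      rw [abs_mul, abs_mul, mul_assoc]
      have h7 : |(l : ℝ) + s| * |gegen s l x| ≤ d * (Q * S) ^ (d - 1) := by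
        calc _ ≤ (d * ((l : ℝ) + 1)) * ((l : ℝ) + 1) ^ (d - 2) := by gcongr
          _ = d * ((l : ℝ) + 1) ^ (d - 1) := by
            rw [show d - 1 = (d - 2) + 1 by omega, pow_succ]; ring
          _ ≤ _ := by gcongr
      gcongr
  have hbound : |(1 - x) ^ M * T| ≤ K * R ^ (2 * M) * d * Q ^ d * (S ^ d / S ^ (2 * M)) := by
    rw [hiter]
    refine (Finset.abs_sum_le_sum_abs _ _).trans ((Finset.sum_le_sum hterm).trans ?_)
    rw [Finset.sum_const, Finset.card_range, nsmul_eq_mul]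
    calc ((n + 1 : ℕ) : ℝ) * (K * R ^ (2 * M) / S ^ (2 * M) * (d * (Q * S) ^ (d - 1)))
        ≤ (Q * S) * (K * R ^ (2 * M) / S ^ (2 * M) * (d * (Q * S) ^ (d - 1))) := by gcongr
      _ = K * R ^ (2 * M) / S ^ (2 * M) * d * (Q * S) ^ ((d - 1) + 1) := by rw [pow_succ]; ring
      _ = _ := by rw [show d - 1 + 1 = d by omega, mul_pow]; ring
  have hcos : 2 / Real.pi ^ 2 * θ ^ 2 ≤ 1 - x := by
    have h1 := Real.mul_le_sin (x := θ / 2) (by linarith) (by linarith)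
    have h2 : 1 - x = 2 * Real.sin (θ / 2) ^ 2 := by
      rw [hx, Real.sin_sq_eq_half_sub, show 2 * (θ / 2) = θ by ring]; ring
    have h3 : 0 ≤ 2 / Real.pi * (θ / 2) := by positivity
    have h4 := pow_le_pow_left₀ h3 h1 2
    rw [h2]
    calc 2 / Real.pi ^ 2 * θ ^ 2 = 2 * (2 / Real.pi * (θ / 2)) ^ 2 := by field_simp
      _ ≤ _ := by linarith
  have hT' : |T| * θ ^ (2 * M) ≤
      (K * R ^ (2 * M) * d * Q ^ d * (S ^ d / S ^ (2 * M))) * (Real.pi ^ 2 / 2) ^ M := by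
    have h1 : θ ^ (2 * M) ≤ (1 - x) ^ M * (Real.pi ^ 2 / 2) ^ M := by
      rw [← mul_pow, pow_mul]
      apply pow_le_pow_left₀ (by positivity)
      calc θ ^ 2 = (2 / Real.pi ^ 2 * θ ^ 2) * (Real.pi ^ 2 / 2) := by field_simp
        _ ≤ _ := by gcongr
    have h2 : 0 ≤ 1 - x := le_trans (by positivity) hcos
    calc |T| * θ ^ (2 * M) ≤ |T| * ((1 - x) ^ M * (Real.pi ^ 2 / 2) ^ M) := by gcongr
      _ = |(1 - x) ^ M * T| * (Real.pi ^ 2 / 2) ^ M := by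
        rw [abs_mul, abs_of_nonneg (pow_nonneg h2 M)]; ring
      _ ≤ _ := by gcongr
  rw [hsum, abs_mul, ← hW, le_div_iff₀ (by positivity), mul_pow, pow_mul B j d, ← hSdef]
  have hSS : S ^ (2 * M) ≠ 0 := by positivity
  calc W * |T| * (S ^ (2 * M) * θ ^ (2 * M)) = W * (|T| * θ ^ (2 * M)) * S ^ (2 * M) := by ring
    _ ≤ W * ((K * R ^ (2 * M) * d * Q ^ d * (S ^ d / S ^ (2 * M))) * (Real.pi ^ 2 / 2) ^ M)
        * S ^ (2 * M) := by gcongr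
    _ = W * (K * R ^ (2 * M) * d * Q ^ d) * (Real.pi ^ 2 / 2) ^ M * S ^ d := by
      field_simp
    _ ≤ _ := by
      have : 0 ≤ S ^ d := by positivity
      linarith
end
end

section
/- Let d ≥ 2 be an integer, B > 1, and let b : [0,∞) → [0,1] be a C^∞ function supported in [1/B, B] with b(1) = 1 and Σ_{j≥0} b(u/B^j)² = 1 for all u ≥ 1; let the angular power spectrum {C_ℓ} satisfy the regularity assumption with parameters α > 2 and β ∈ [0,1). Then for every N ∈ ℕ there exist C_N > 0 and J ∈ ℕ such that for all j ≥ J and θ ∈ (0, π], the standard needlet covariance kernel Φ_j(cos θ) = Σ_ℓ b(ℓ/B^j)² C_ℓ Z_{ℓ;d}(cos θ) satisfies Φ_j(cos θ)/Φ_j(1) ≤ C_N/(B^{(j−1)(1−β)} θ)^{2N}. -/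
noncomputable section

/-! ### Bounds for Gegenbauer polynomials -/

/-- Coefficients of `(1 - t)^{-η}`. -/
def cco (η : ℝ) : ℕ → ℝ
  | 0 => 1
  | (k + 1) => ((k : ℝ) + η) / ((k : ℝ) + 1) * cco η k

theorem cco_succ (η : ℝ) (k : ℕ) : ((k : ℝ) + 1) * cco η (k + 1) = ((k : ℝ) + η) * cco η k := by
  have : (k : ℝ) + 1 ≠ 0 := by positivity
  simp only [cco]
  field_simp

theorem cco_nonneg {η : ℝ} (hη : 0 ≤ η) (k : ℕ) : 0 ≤ cco η k := by
  induction k with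
  | zero => simp [cco]
  | succ k ih => simp only [cco]; positivity

/-- The power series `(1 - w t)^{-η}`. -/
def Pser (η : ℝ) (w : ℂ) : PowerSeries ℂ := PowerSeries.mk fun k => (cco η k : ℂ) * w ^ k

open PowerSeries in
theorem Pser_deriv (η : ℝ) (w : ℂ) :
    (1 - C w * X) * derivative ℂ (Pser η w) = C ((η : ℂ) * w) * Pser η w := by
  ext n
  have h : ∀ k : ℕ, ((k : ℂ) + 1) * (cco η (k + 1) : ℂ) = ((k : ℂ) + η) * cco η k := by
    intro k
    exact_mod_cast congrArg (fun r : ℝ => (r : ℂ)) (cco_succ η k)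
  rw [sub_mul, one_mul, mul_assoc, map_sub, coeff_C_mul, coeff_C_mul, coeff_derivative]
  cases n with
  | zero =>
    simp only [Pser, coeff_mk, coeff_zero_X_mul]
    have := h 0
    push_cast at *
    linear_combination w * this
  | succ n =>
    rw [coeff_succ_X_mul, coeff_derivative]
    simp only [Pser, coeff_mk]
    have := h (n + 1)
    push_cast at *
    linear_combination w ^ (n + 2) * this

open PowerSeries in
theorem gegen_coeff (η x : ℝ) (w w' : ℂ) (hw : w * w' = 1) (hs : w + w' = 2 * x) (n : ℕ) :
    (gegen η n x : ℂ) = coeff n (Pser η w * Pser η w') := by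
  have key : (1 - C (2 * (x : ℂ)) * X + X * X) * derivative ℂ (Pser η w * Pser η w')
      = (C (2 * (η : ℂ) * x) - C (2 * (η : ℂ)) * X) * (Pser η w * Pser η w') := by
    have h1 := Pser_deriv η w
    have h2 := Pser_deriv η w'
    have e1 : (C w : PowerSeries ℂ) * C w' = 1 := by rw [← map_mul, hw, map_one]
    have e2 : (C w : PowerSeries ℂ) + C w' = 2 * C (x : ℂ) := by
      rw [← map_add, hs, map_mul, map_ofNat]
    have e3 : (C (2 * (x : ℂ)) : PowerSeries ℂ) = C w + C w' := by rw [← hs, map_add]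
    have e4 : (C (2 * (η : ℂ) * x) : PowerSeries ℂ) = C (η : ℂ) * (C w + C w') := by
      rw [← map_add, hs, ← map_mul]; congr 1; ring
    have e5 : (C (2 * (η : ℂ)) : PowerSeries ℂ) = 2 * C (η : ℂ) := by
      rw [map_mul, map_ofNat]
    rw [e3, e4, e5, Derivation.leibniz, smul_eq_mul, smul_eq_mul]
    rw [map_mul] at h1 h2
    have e6 : (1 - (C w + C w') * X + X * X : PowerSeries ℂ) = (1 - C w * X) * (1 - C w' * X) := by
      linear_combination (- X * X) * e1
    rw [e6]
    linear_combination (1 - C w * X) * Pser η w * h2 + (1 - C w' * X) * Pser η w' * h1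
      - 2 * C (η : ℂ) * X * Pser η w * Pser η w' * e1
  have c0 : coeff 0 (Pser η w * Pser η w') = 1 := by
    simp [Pser, cco]
  have rec0 : coeff 1 (Pser η w * Pser η w') = 2 * η * x := by
    have := congrArg (coeff 0) key
    rw [add_mul, sub_mul, sub_mul, one_mul, mul_assoc (C (2 * (x : ℂ))), mul_assoc X,
      mul_assoc (C (2 * (η : ℂ))), map_add, map_sub,
      map_sub, coeff_C_mul, coeff_C_mul, coeff_C_mul, coeff_zero_X_mul, coeff_zero_X_mul,
      coeff_zero_X_mul, coeff_derivative, c0] at this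
    simp only [zero_add] at this
    push_cast at this
    linear_combination this
  have recn : ∀ n : ℕ, ((n : ℂ) + 2) * coeff (n + 2) (Pser η w * Pser η w') =
      2 * ((n : ℂ) + 1 + η) * x * coeff (n + 1) (Pser η w * Pser η w')
        - ((n : ℂ) + 1 + 2 * η - 1) * coeff n (Pser η w * Pser η w') := by
    intro n
    have := congrArg (coeff (n + 1)) key
    rw [add_mul, sub_mul, sub_mul, one_mul, mul_assoc (C (2 * (x : ℂ))), mul_assoc X,
      mul_assoc (C (2 * (η : ℂ))), map_add, map_sub,
      map_sub, coeff_C_mul, coeff_C_mul, coeff_C_mul, coeff_succ_X_mul, coeff_succ_X_mul,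
      coeff_succ_X_mul, coeff_derivative, coeff_derivative] at this
    cases n with
    | zero =>
      rw [coeff_zero_X_mul] at this
      push_cast at *
      linear_combination this
    | succ n =>
      rw [coeff_succ_X_mul, coeff_derivative] at this
      push_cast at *
      linear_combination this
  induction n using Nat.twoStepInduction with
  | zero => rw [c0]; simp [gegen]
  | one => rw [rec0]; simp [gegen]
  | more n h1 h2 =>
    have h3 := recn n
    rw [← h1, ← h2] at h3
    have h4 : (n : ℂ) + 2 ≠ 0 := by exact_mod_cast (Nat.succ_ne_zero (n + 1))
    simp only [gegen]
    push_cast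
    rw [div_eq_iff h4, ← h3]
    ring

open PowerSeries in
theorem gegen_abs_le {η : ℝ} (hη : 0 ≤ η) (n : ℕ) (θ : ℝ) :
    |gegen η n (Real.cos θ)| ≤ gegen η n 1 := by
  have h1 := gegen_coeff η (Real.cos θ) (Complex.exp (θ * Complex.I))
    (Complex.exp (-(θ * Complex.I))) (by rw [← Complex.exp_add]; simp)
    (by rw [Complex.ofReal_cos, Complex.two_cos]; ring_nf) n
  have h2 := gegen_coeff η 1 1 1 (by simp) (by push_cast; ring) n
  have h3 : (gegen η n 1 : ℂ) = ((∑ p ∈ Finset.HasAntidiagonal.antidiagonal n, cco η p.1 * cco η p.2 : ℝ) : ℂ) := by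
    rw [h2, coeff_mul]; simp [Pser]
  have h4 : gegen η n 1 = ∑ p ∈ Finset.HasAntidiagonal.antidiagonal n, cco η p.1 * cco η p.2 := by
    exact_mod_cast h3
  rw [h4, ← Real.norm_eq_abs, ← Complex.norm_real, h1, coeff_mul]
  refine (norm_sum_le _ _).trans (Finset.sum_le_sum fun p _ => ?_)
  have hn1 : ‖Complex.exp (θ * Complex.I)‖ = 1 := Complex.norm_exp_ofReal_mul_I θ
  have hn2 : ‖Complex.exp (-(θ * Complex.I))‖ = 1 := by
    rw [Complex.exp_neg, norm_inv, hn1, inv_one]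
  simp only [Pser, coeff_mk, norm_mul, norm_pow, hn1, hn2, one_pow, mul_one, Complex.norm_real,
    Real.norm_eq_abs, abs_of_nonneg (cco_nonneg hη _)]
  exact le_rfl

theorem gegen_one_succ (η : ℝ) (n : ℕ) :
    ((n : ℝ) + 1) * gegen η (n + 1) 1 = ((n : ℝ) + 2 * η) * gegen η n 1 := by
  induction n with
  | zero => simp [gegen]
  | succ n ih =>
    have h4 : (n : ℝ) + 2 ≠ 0 := by positivity
    have : ((n : ℝ) + 2) * gegen η (n + 2) 1 = 2 * ((n : ℝ) + 1 + η) * 1 * gegen η (n + 1) 1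
        - ((n : ℝ) + 1 + 2 * η - 1) * gegen η n 1 := by
      simp only [gegen]; field_simp
    push_cast
    linear_combination this + ih

theorem gegen_one_eq (m n : ℕ) :
    gegen (etaD (m + 2)) n 1 = ((n + m).choose m : ℝ) := by
  induction n with
  | zero => simp [gegen]
  | succ n ih =>
    have h := gegen_one_succ (etaD (m + 2)) n
    rw [ih] at h
    have h5 : (2 : ℝ) * etaD (m + 2) = m + 1 := by simp [etaD]; ring
    rw [h5] at h
    have h6 : ((n : ℝ) + 1) * ((n + 1 + m).choose m : ℝ) = (n + (m + 1)) * ((n + m).choose m : ℝ) := by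
      have h7 := Nat.choose_mul_succ_eq (n + m) m
      have h8 : n + m + 1 - m = n + 1 := by omega
      rw [h8] at h7
      have h9 : ((n + m).choose m : ℝ) * (n + m + 1) = ((n + m + 1).choose m : ℝ) * (n + 1) := by
        exact_mod_cast h7
      rw [show n + 1 + m = n + m + 1 by ring]
      linear_combination -h9
    have h4 : (n : ℝ) + 1 ≠ 0 := by positivity
    exact mul_left_cancel₀ h4 (h.trans h6.symm)

theorem gegen_one_le (m n : ℕ) : gegen (etaD (m + 2)) n 1 ≤ ((n : ℝ) + m) ^ m := by
  rw [gegen_one_eq]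
  exact_mod_cast Nat.choose_le_pow (n + m) m

theorem le_gegen_one (m n : ℕ) : (n : ℝ) ^ m / m.factorial ≤ gegen (etaD (m + 2)) n 1 := by
  rw [gegen_one_eq]
  refine le_trans ?_ (Nat.pow_le_choose (α := ℝ) m (n + m))
  have : n + m + 1 - m = n + 1 := by omega
  rw [this]
  push_cast
  gcongr
  linarith

/-! ### Finite differences and a symbol class -/

/-- Forward difference. -/
def dl (f : ℝ → ℝ) : ℝ → ℝ := fun u => f (u + 1) - f u

theorem dl_iter_shift (c : ℝ) (k : ℕ) (f : ℝ → ℝ) (u : ℝ) :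
    dl^[k] (fun v => f (v + c)) u = dl^[k] f (u + c) := by
  induction k generalizing f with
  | zero => rfl
  | succ k ih =>
    rw [Function.iterate_succ_apply, Function.iterate_succ_apply, ← ih]
    refine congrArg (fun F => dl^[k] F u) ?_
    funext v
    simp only [dl]
    rw [add_right_comm]

theorem dl_iter_add (k : ℕ) (f h : ℝ → ℝ) (u : ℝ) :
    dl^[k] (fun v => f v + h v) u = dl^[k] f u + dl^[k] h u := by
  induction k generalizing f h with
  | zero => rfl
  | succ k ih =>
    rw [Function.iterate_succ_apply, Function.iterate_succ_apply, Function.iterate_succ_apply,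
      ← ih]
    refine congrArg (fun F => dl^[k] F u) ?_
    funext v
    simp only [dl]
    ring

theorem dl_iter_const_mul (k : ℕ) (c : ℝ) (f : ℝ → ℝ) (u : ℝ) :
    dl^[k] (fun v => c * f v) u = c * dl^[k] f u := by
  induction k generalizing f with
  | zero => rfl
  | succ k ih =>
    rw [Function.iterate_succ_apply, Function.iterate_succ_apply, ← ih]
    refine congrArg (fun F => dl^[k] F u) ?_
    funext v
    simp only [dl]
    ring

/-- Symbol class: families `f R`, `R ≥ 1`, whose `k`-th differences on `[R + n, ∞)` are
`O(R^(σ - γ k))`. -/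
def Bd (γ n σ : ℝ) (f : ℝ → ℝ → ℝ) : Prop :=
  ∀ k : ℕ, ∃ C : ℝ, 0 ≤ C ∧ ∀ R : ℝ, 1 ≤ R → ∀ u : ℝ, R + n ≤ u →
    |dl^[k] (f R) u| ≤ C * R ^ (σ - γ * k)

theorem Bd.mono {γ n σ n' σ' : ℝ} {f : ℝ → ℝ → ℝ} (h : Bd γ n σ f) (hn : n ≤ n') (hσ : σ ≤ σ') :
    Bd γ n' σ' f := by
  intro k
  obtain ⟨C, hC, h⟩ := h k
  refine ⟨C, hC, fun R hR u hu => (h R hR u (by linarith)).trans ?_⟩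
  gcongr

theorem Bd.add {γ n σ : ℝ} {f h : ℝ → ℝ → ℝ} (hf : Bd γ n σ f) (hh : Bd γ n σ h) :
    Bd γ n σ (fun R u => f R u + h R u) := by
  intro k
  obtain ⟨C, hC, hf⟩ := hf k
  obtain ⟨D, hD, hh⟩ := hh k
  refine ⟨C + D, by positivity, fun R hR u hu => ?_⟩
  rw [dl_iter_add, add_mul]
  exact (abs_add_le _ _).trans (add_le_add (hf R hR u hu) (hh R hR u hu))

theorem Bd.const_mul {γ n σ : ℝ} {f : ℝ → ℝ → ℝ} (c : ℝ) (hf : Bd γ n σ f) :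
    Bd γ n σ (fun R u => c * f R u) := by
  intro k
  obtain ⟨C, hC, hf⟩ := hf k
  refine ⟨|c| * C, by positivity, fun R hR u hu => ?_⟩
  rw [dl_iter_const_mul, abs_mul, mul_assoc]
  exact mul_le_mul_of_nonneg_left (hf R hR u hu) (abs_nonneg c)

theorem Bd.shift {γ n σ : ℝ} {f : ℝ → ℝ → ℝ} (c : ℝ) (hf : Bd γ n σ f) :
    Bd γ (n - c) σ (fun R u => f R (u + c)) := by
  intro k
  obtain ⟨C, hC, hf⟩ := hf k
  refine ⟨C, hC, fun R hR u hu => ?_⟩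
  rw [dl_iter_shift]
  exact hf R hR _ (by linarith)

theorem Bd.dl {γ n σ : ℝ} {f : ℝ → ℝ → ℝ} (hf : Bd γ n σ f) :
    Bd γ n (σ - γ) (fun R => dl (f R)) := by
  intro k
  obtain ⟨C, hC, hf⟩ := hf (k + 1)
  refine ⟨C, hC, fun R hR u hu => ?_⟩
  have := hf R hR u hu
  rw [Function.iterate_succ_apply] at this
  refine this.trans (le_of_eq ?_)
  push_cast
  ring_nf

theorem Bd.mul {γ n σ τ : ℝ} {f h : ℝ → ℝ → ℝ} (hf : Bd γ n σ f) (hh : Bd γ n τ h) :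
    Bd γ n (σ + τ) (fun R u => f R u * h R u) := by
  intro k
  induction k generalizing f h σ τ with
  | zero =>
    obtain ⟨C, hC, hf⟩ := hf 0
    obtain ⟨D, hD, hh⟩ := hh 0
    refine ⟨C * D, by positivity, fun R hR u hu => ?_⟩
    have h1 := hf R hR u hu
    have h2 := hh R hR u hu
    simp only [Function.iterate_zero, id_eq, Nat.cast_zero, mul_zero, sub_zero] at *
    have hR0 : (0 : ℝ) < R := by linarith
    rw [Real.rpow_add hR0, abs_mul]
    calc |f R u| * |h R u| ≤ (C * R ^ σ) * (D * R ^ τ) := by gcongr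
      _ = _ := by ring
  | succ k ih =>
    obtain ⟨C, hC, h1⟩ := ih hf.dl hh
    obtain ⟨D, hD, h2⟩ := ih ((hf.shift 1).mono (by linarith : n - 1 ≤ n) le_rfl) hh.dl
    refine ⟨C + D, by positivity, fun R hR u hu => ?_⟩
    have e : _root_.dl (fun v => f R v * h R v) =
        fun v => (_root_.dl (f R) v * h R v) + (f R (v + 1) * _root_.dl (h R) v) := by
      funext v
      simp only [_root_.dl]
      ring
    rw [Function.iterate_succ_apply, e, dl_iter_add, add_mul]
    refine (abs_add_le _ _).trans (add_le_add ((h1 R hR u hu).trans (le_of_eq ?_))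
      ((h2 R hR u hu).trans (le_of_eq ?_)))
    · push_cast; ring_nf
    · push_cast; ring_nf

theorem dl_iter_hasDeriv {r : ℝ} (F F' : ℝ → ℝ) (h : ∀ u, r ≤ u → HasDerivAt F (F' u) u) (k : ℕ) :
    ∀ u, r ≤ u → HasDerivAt (dl^[k] F) (dl^[k] F' u) u := by
  induction k with
  | zero => exact h
  | succ k ih =>
    intro u hu
    rw [Function.iterate_succ_apply', Function.iterate_succ_apply']
    have h1 : HasDerivAt (fun v => dl^[k] F (v + 1)) (dl^[k] F' (u + 1)) u :=
      HasDerivAt.comp_add_const u 1 (ih (u + 1) (by linarith))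
    exact h1.sub (ih u hu)

theorem dl_iter_le_deriv {r : ℝ} (F : ℕ → ℝ → ℝ) (D : ℕ → ℝ)
    (h : ∀ k u, r ≤ u → HasDerivAt (F k) (F (k + 1) u) u)
    (hD : ∀ k u, r ≤ u → |F k u| ≤ D k) (k : ℕ) :
    ∀ m u, r ≤ u → |dl^[k] (F m) u| ≤ D (m + k) := by
  induction k with
  | zero => exact fun m u hu => hD m u hu
  | succ k ih =>
    intro m u hu
    rw [Function.iterate_succ_apply']
    have hd := dl_iter_hasDeriv (F m) (F (m + 1)) (h m) k
    obtain ⟨c, hc, hc'⟩ := exists_hasDerivAt_eq_slope (dl^[k] (F m)) (dl^[k] (F (m + 1)))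
      (show u < u + 1 by linarith)
      (fun v hv => (hd v (hu.trans hv.1)).continuousAt.continuousWithinAt)
      (fun v hv => hd v (hu.trans hv.1.le))
    have := ih (m + 1) c (hu.trans hc.1.le)
    rw [hc'] at this
    simp only [dl]
    rw [show u + 1 - u = 1 by ring, div_one] at this
    rwa [show m + (k + 1) = m + 1 + k by ring]

theorem Bd.of_deriv {γ σ : ℝ} {f : ℝ → ℝ → ℝ} (F : ℝ → ℕ → ℝ → ℝ) (C : ℕ → ℝ)
    (hF : ∀ R, F R 0 = f R)
    (h : ∀ R, 1 ≤ R → ∀ k u, R ≤ u → HasDerivAt (F R k) (F R (k + 1) u) u)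
    (hC : ∀ R, 1 ≤ R → ∀ k u, R ≤ u → |F R k u| ≤ C k * R ^ (σ - γ * k)) :
    Bd γ 0 σ f := by
  intro k
  refine ⟨|C k|, abs_nonneg _, fun R hR u hu => ?_⟩
  have := dl_iter_le_deriv (F R) (fun k => C k * R ^ (σ - γ * k)) (h R hR) (hC R hR) k 0 u
    (by linarith)
  rw [hF, zero_add] at this
  refine this.trans ?_
  have hR0 : (0 : ℝ) < R := by linarith
  gcongr
  exact le_abs_self _

theorem Bd_rpow {γ : ℝ} (hγ : γ ≤ 1) {η : ℝ} (hη : 0 ≤ η) {p : ℝ} (hp : p ≤ 0) :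
    Bd γ 0 p (fun _ u => (u + η) ^ p) := by
  refine Bd.of_deriv (fun _ k u => (descPochhammer ℝ k).eval p * (u + η) ^ (p - k))
    (fun k => |(descPochhammer ℝ k).eval p|) ?_ ?_ ?_
  · intro R; funext u; simp
  · intro R hR k u hu
    have h1 : u + η ≠ 0 := by linarith
    have h2 := ((Real.hasDerivAt_rpow_const (p := p - k) (Or.inl h1)).comp_add_const u η).const_mul
      ((descPochhammer ℝ k).eval p)
    refine h2.congr_deriv ?_
    rw [descPochhammer_succ_eval]
    push_cast
    rw [show p - (k + 1 : ℝ) = p - k - 1 by ring]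
    ring
  · intro R hR k u hu
    have hR0 : (0 : ℝ) < R := by linarith
    rw [abs_mul, abs_of_nonneg (Real.rpow_nonneg (by linarith : 0 ≤ u + η) _)]
    gcongr
    calc (u + η) ^ (p - k) ≤ R ^ (p - k) := by
          apply Real.rpow_le_rpow_of_nonpos hR0 (by linarith)
          have : (0 : ℝ) ≤ k := by positivity
          linarith
      _ ≤ R ^ (p - γ * k) := by
          apply Real.rpow_le_rpow_of_exponent_le hR
          have : (0 : ℝ) ≤ k := by positivity
          nlinarith

theorem Bd_g {β : ℝ} {g : ℝ → ℝ} {g₁ g₂ : ℝ} {A : ℕ → ℝ} (hβ1 : β < 1) (hg12 : 0 < g₁)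
    (hgC : ContDiffOn ℝ (⊤ : ℕ∞) g (Set.Ioi 0))
    (hgpos : ∀ u : ℝ, 0 < u → g₁ ≤ g u ∧ g u ≤ g₂)
    (hgder : ∀ r : ℕ, 1 ≤ r → ∀ u : ℝ, 1 ≤ u →
      |iteratedDeriv r g u| ≤ A r * u ^ (-(1 - β) * (r : ℝ))) :
    Bd (1 - β) 0 0 (fun _ u => g u) := by
  have hs : ∀ k : ℕ, ContDiffOn ℝ (⊤ : ℕ∞) (iteratedDeriv k g) (Set.Ioi 0) := by
    intro k
    induction k with
    | zero => simpa using hgC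
    | succ k ih =>
      rw [iteratedDeriv_succ]
      exact ih.deriv_of_isOpen isOpen_Ioi (by simp)
  refine Bd.of_deriv (fun _ k => iteratedDeriv k g) (fun k => if k = 0 then g₂ else |A k|) ?_ ?_ ?_
  · intro R; simp
  · intro R hR k u hu
    have hu0 : u ∈ Set.Ioi (0 : ℝ) := by simp only [Set.mem_Ioi]; linarith
    rw [iteratedDeriv_succ]
    exact (((hs k).contDiffAt (isOpen_Ioi.mem_nhds hu0)).differentiableAt (by simp)).hasDerivAt
  · intro R hR k u hu
    have hR0 : (0 : ℝ) < R := by linarith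
    rcases Nat.eq_zero_or_pos k with rfl | hk
    · have := hgpos u (by linarith)
      simp only [iteratedDeriv_zero, if_true, Nat.cast_zero, mul_zero, sub_zero, Real.rpow_zero,
        mul_one]
      rw [abs_of_nonneg (by linarith)]
      exact this.2
    · rw [if_neg (by omega)]
      refine (hgder k hk u (by linarith)).trans ?_
      have hu0 : (0 : ℝ) < u := by linarith
      calc A k * u ^ (-(1 - β) * (k : ℝ)) ≤ |A k| * u ^ (-(1 - β) * (k : ℝ)) := by
            gcongr; exact le_abs_self _
        _ ≤ |A k| * R ^ (0 - (1 - β) * (k : ℝ)) := by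
            gcongr
            rw [show (0 - (1 - β) * (k : ℝ)) = -(1 - β) * (k : ℝ) by ring]
            apply Real.rpow_le_rpow_of_nonpos hR0 hu
            have : (0 : ℝ) ≤ k := by positivity
            nlinarith

theorem Bd_b {γ B : ℝ} {b : ℝ → ℝ} (hγ : γ ≤ 1) (hB : 1 < B) (hbC : ContDiff ℝ (⊤ : ℕ∞) b)
    (hbsupp : ∀ u : ℝ, u ∉ Set.Icc (1 / B) B → b u = 0) :
    Bd γ 0 0 (fun R u => b (u / (2 * B * R))) := by
  have hcs : HasCompactSupport b := HasCompactSupport.intro isCompact_Icc hbsupp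
  have hbd : ∀ k : ℕ, ∃ C, ∀ u, |iteratedDeriv k b u| ≤ C := by
    intro k
    have h1 : HasCompactSupport (iteratedDeriv k b) := by
      induction k with
      | zero => simpa using hcs
      | succ k ih => rw [iteratedDeriv_succ]; exact ih.deriv
    exact (hbC.continuous_iteratedDeriv k (by exact_mod_cast le_top)).bounded_above_of_compact_support h1
  choose C hC using hbd
  refine Bd.of_deriv (fun R k u => (1 / (2 * B * R)) ^ k * iteratedDeriv k b (u / (2 * B * R)))
    C ?_ ?_ ?_
  · intro R; simp
  · intro R hR k u hu
    have hd : HasDerivAt (iteratedDeriv k b) (iteratedDeriv (k + 1) b (u / (2 * B * R)))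
        (u / (2 * B * R)) := by
      rw [iteratedDeriv_succ]
      exact ((hbC.differentiable_iteratedDeriv k
        (by exact_mod_cast ENat.natCast_lt_top k)) _).hasDerivAt
    have h2 := (hd.comp u ((hasDerivAt_id u).div_const (2 * B * R))).const_mul
      ((1 / (2 * B * R)) ^ k)
    refine h2.congr_deriv ?_
    rw [pow_succ]; ring
  · intro R hR k u hu
    have hR0 : (0 : ℝ) < R := by linarith
    have hP : (0 : ℝ) < 2 * B * R := by positivity
    rw [abs_mul, abs_of_nonneg (by positivity), mul_comm]
    have hC0 : 0 ≤ C k := (abs_nonneg _).trans (hC k 0)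
    gcongr
    · exact hC k _
    · calc (1 / (2 * B * R)) ^ k ≤ (1 / R) ^ k := by
            gcongr
            nlinarith
        _ = R ^ (-(k : ℝ)) := by rw [Real.rpow_neg hR0.le, Real.rpow_natCast, one_div, inv_pow]
        _ ≤ R ^ (0 - γ * k) := by
          apply Real.rpow_le_rpow_of_exponent_le hR
          have : (0 : ℝ) ≤ k := by positivity
          nlinarith

/-! ### The second order difference operator -/

/-- Multiplication by `1 - x` on the coefficient side. -/
def Dop (η : ℝ) (f : ℝ → ℝ) : ℝ → ℝ := fun u =>
  -(1 / 2) * ((1 + -η * (u + η) ^ (-1 : ℝ)) * dl (dl f) (u + -1)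
    + 2 * η * ((u + η) ^ (-1 : ℝ) * dl f u))

theorem Bd_const {γ : ℝ} (hγ : γ ≤ 1) : Bd γ 0 0 (fun _ _ => (1 : ℝ)) := by
  have := Bd_rpow hγ (le_refl (0 : ℝ)) (le_refl (0 : ℝ))
  simpa using this

theorem Bd.Dop {γ σ η n : ℝ} {f : ℝ → ℝ → ℝ} (hγ0 : 0 ≤ γ) (hγ : γ ≤ 1) (hη : 0 ≤ η) (hn : 0 ≤ n)
    (hf : Bd γ n σ f) : Bd γ (n + 1) (σ - 2 * γ) (fun R => Dop η (f R)) := by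
  have hw : Bd γ (n + 1) (-1) (fun _ u => (u + η) ^ (-1 : ℝ)) :=
    (Bd_rpow hγ hη (by norm_num)).mono (by linarith) le_rfl
  have h1 : Bd γ (n + 1) 0 (fun _ u => 1 + -η * (u + η) ^ (-1 : ℝ)) :=
    ((Bd_const hγ).mono (by linarith) le_rfl).add
      ((hw.mono le_rfl (by norm_num)).const_mul (-η))
  have h2 := (hf.dl.dl.shift (-1)).mono (by linarith : n - -1 ≤ n + 1) le_rfl
  have h3 := (hf.dl.mono (by linarith : n ≤ n + 1) le_rfl)
  have h4 := (h1.mul h2).mono le_rfl (by linarith : 0 + (σ - γ - γ) ≤ σ - 2 * γ)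
  have h5 := (hw.mul h3).mono le_rfl (by linarith : -1 + (σ - γ) ≤ σ - 2 * γ)
  exact (h4.add (h5.const_mul (2 * η))).const_mul (-(1 / 2))

theorem Bd.Dop_iter {γ σ η : ℝ} {f : ℝ → ℝ → ℝ} (hγ0 : 0 ≤ γ) (hγ : γ ≤ 1) (hη : 0 ≤ η)
    (hf : Bd γ 0 σ f) (N : ℕ) :
    Bd γ N (σ - 2 * γ * N) (fun R => (_root_.Dop η)^[N] (f R)) := by
  induction N with
  | zero => simpa using hf
  | succ N ih =>
    have := ih.Dop hγ0 hγ hη (by positivity)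
    simp only [Function.iterate_succ_apply']
    push_cast
    exact this.mono le_rfl (by linarith)

theorem Dop_apply (η : ℝ) (f : ℝ → ℝ) (u : ℝ) (hu : u + η ≠ 0) :
    Dop η f u * (u + η) = (u + η) * f u - 1 / 2 * u * f (u - 1)
      - 1 / 2 * (u + 2 * η) * f (u + 1) := by
  simp only [Dop, dl, Real.rpow_neg_one]
  rw [show u + -1 + 1 = u by ring, show u + -1 = u - 1 by ring]
  field_simp
  ring

theorem Dop_zero_of_lt {η a : ℝ} {f : ℝ → ℝ} (hf : ∀ u, u < a → f u = 0) :
    ∀ u, u < a - 1 → Dop η f u = 0 := by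
  intro u hu
  simp only [Dop, dl]
  rw [hf _ (by linarith : u + 1 < a), hf _ (by linarith : u < a),
    hf _ (by linarith : u + -1 + 1 + 1 < a), hf _ (by linarith : u + -1 + 1 < a),
    hf _ (by linarith : u + -1 < a)]
  ring

theorem Dop_zero_of_gt {η a : ℝ} {f : ℝ → ℝ} (hf : ∀ u, a < u → f u = 0) :
    ∀ u, a + 1 < u → Dop η f u = 0 := by
  intro u hu
  simp only [Dop, dl]
  rw [hf _ (by linarith : a < u + 1), hf _ (by linarith : a < u),
    hf _ (by linarith : a < u + -1 + 1 + 1), hf _ (by linarith : a < u + -1 + 1),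
    hf _ (by linarith : a < u + -1)]
  ring

theorem Dop_iter_zero_of_lt {η a : ℝ} {f : ℝ → ℝ} (hf : ∀ u, u < a → f u = 0) (N : ℕ) :
    ∀ u, u < a - N → (Dop η)^[N] f u = 0 := by
  induction N with
  | zero => simpa using hf
  | succ N ih =>
    rw [Function.iterate_succ_apply']
    intro u hu
    push_cast at hu
    exact Dop_zero_of_lt ih u (by linarith)

theorem Dop_iter_zero_of_gt {η a : ℝ} {f : ℝ → ℝ} (hf : ∀ u, a < u → f u = 0) (N : ℕ) :
    ∀ u, a + N < u → (Dop η)^[N] f u = 0 := by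
  induction N with
  | zero => simpa using hf
  | succ N ih =>
    rw [Function.iterate_succ_apply']
    intro u hu
    push_cast at hu
    exact Dop_zero_of_gt ih u (by linarith)

theorem sum_Dop (η x : ℝ) (hη : 0 < η) (f : ℝ → ℝ) (L : ℕ) :
    (1 - x) * ∑ l ∈ Finset.range (L + 1), f l * ((l : ℝ) + η) * gegen η l x =
      ∑ l ∈ Finset.range (L + 1), Dop η f l * ((l : ℝ) + η) * gegen η l x
        + 1 / 2 * ((L : ℝ) + 2 * η) * f (L + 1) * gegen η L x
        - 1 / 2 * ((L : ℝ) + 1) * f L * gegen η (L + 1) x := by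
  induction L with
  | zero =>
    have := Dop_apply η f 0 (by linarith)
    simp only [zero_add, Finset.sum_range_one, gegen, Nat.cast_zero] at this ⊢
    rw [this]
    ring
  | succ L ih =>
    have h := Dop_apply η f ((L + 1 : ℕ) : ℝ) (by positivity)
    rw [Finset.sum_range_succ, mul_add, ih, Finset.sum_range_succ _ (L + 1), h]
    have h4 : (L : ℝ) + 2 ≠ 0 := by positivity
    have hr : ((L : ℝ) + 2) * gegen η (L + 2) x = 2 * ((L : ℝ) + 1 + η) * x * gegen η (L + 1) x
        - ((L : ℝ) + 1 + 2 * η - 1) * gegen η L x := by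
      simp only [gegen]; field_simp
    rw [show L + 1 + 1 = L + 2 by ring]
    push_cast
    rw [show (L : ℝ) + 1 - 1 = L by ring]
    linear_combination (1 / 2 * f (L + 1)) * hr

theorem sum_Dop_iter (η x : ℝ) (hη : 0 < η) (f : ℝ → ℝ) (a : ℝ) (hf : ∀ u, a < u → f u = 0)
    (N L : ℕ) (hL : a + N < L) :
    (1 - x) ^ N * ∑ l ∈ Finset.range (L + 1), f l * ((l : ℝ) + η) * gegen η l x =
      ∑ l ∈ Finset.range (L + 1), (Dop η)^[N] f l * ((l : ℝ) + η) * gegen η l x := by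
  induction N with
  | zero => simp
  | succ N ih =>
    push_cast at hL
    rw [pow_succ', mul_assoc, ih (by linarith), sum_Dop η x hη, Function.iterate_succ_apply',
      Dop_iter_zero_of_gt hf N L (by linarith), Dop_iter_zero_of_gt hf N (L + 1) (by linarith)]
    ring

/-- The coefficient family, `R = B^j / (2B)`. -/
def fam (b g : ℝ → ℝ) (α B R u : ℝ) : ℝ := b (u / (2 * B * R)) ^ 2 * (u ^ (-α) * g u)

theorem fam_zero_of_lt {b g : ℝ → ℝ} {α B R : ℝ} (hB : 1 < B) (hR : 1 ≤ R)
    (hbsupp : ∀ u : ℝ, u ∉ Set.Icc (1 / B) B → b u = 0) :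
    ∀ u, u < 2 * R → fam b g α B R u = 0 := by
  intro u hu
  have hB0 : 0 < B := by linarith
  have : b (u / (2 * B * R)) = 0 := by
    apply hbsupp
    rintro ⟨h, -⟩
    rw [le_div_iff₀ (by positivity)] at h
    have : 1 / B * (2 * B * R) = 2 * R := by field_simp
    linarith
  simp [fam, this]

theorem fam_zero_of_gt {b g : ℝ → ℝ} {α B R : ℝ} (hB : 1 < B) (hR : 1 ≤ R)
    (hbsupp : ∀ u : ℝ, u ∉ Set.Icc (1 / B) B → b u = 0) :
    ∀ u, B * (2 * B * R) < u → fam b g α B R u = 0 := by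
  intro u hu
  have hB0 : 0 < B := by linarith
  have : b (u / (2 * B * R)) = 0 := by
    apply hbsupp
    rintro ⟨-, h⟩
    rw [div_le_iff₀ (by positivity)] at h
    linarith
  simp [fam, this]

theorem upper_bound {m : ℕ} {B : ℝ} (hB : 1 < B) {b g : ℝ → ℝ} {g₁ g₂ : ℝ} {A : ℕ → ℝ} {α β : ℝ}
    (hbC : ContDiff ℝ (⊤ : ℕ∞) b)
    (hbsupp : ∀ u : ℝ, u ∉ Set.Icc (1 / B) B → b u = 0)
    (hα : 2 < α) (hβ0 : 0 ≤ β) (hβ1 : β < 1) (hg12 : 0 < g₁)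
    (hgC : ContDiffOn ℝ (⊤ : ℕ∞) g (Set.Ioi 0))
    (hgpos : ∀ u : ℝ, 0 < u → g₁ ≤ g u ∧ g u ≤ g₂)
    (hgder : ∀ r : ℕ, 1 ≤ r → ∀ u : ℝ, 1 ≤ u →
      |iteratedDeriv r g u| ≤ A r * u ^ (-(1 - β) * (r : ℝ))) (N : ℕ) :
    ∃ C : ℝ, 0 ≤ C ∧ ∀ R : ℝ, 1 ≤ R → 2 * (N : ℝ) ≤ R → ∀ θ : ℝ,
      (1 - Real.cos θ) ^ N * ∑ l ∈ Finset.range (⌈B * (2 * B * R)⌉₊ + N + 2),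
        fam b g α B R l * ((l : ℝ) + etaD (m + 2)) * gegen (etaD (m + 2)) l (Real.cos θ) ≤
      C * (R ^ (-α - 2 * (1 - β) * N) * R ^ (m + 2)) := by
  have hB0 : 0 < B := by linarith
  have hη : 0 < etaD (m + 2) := by
    simp only [etaD]; push_cast; have : (0 : ℝ) ≤ m := by positivity
    linarith
  have hη' : etaD (m + 2) ≤ m + 2 := by
    simp only [etaD]; push_cast; have : (0 : ℝ) ≤ m := by positivity
    linarith
  have hfam : Bd (1 - β) 0 (-α) (fam b g α B) := by
    have h1 := Bd_b (γ := 1 - β) (by linarith) hB hbC hbsupp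
    have h2 := Bd_rpow (γ := 1 - β) (by linarith) (le_refl (0 : ℝ)) (p := -α) (by linarith)
    have h3 := Bd_g hβ1 hg12 hgC hgpos hgder
    have h4 := ((h1.mul h1).mul (h2.mul h3)).mono le_rfl (by linarith : 0 + 0 + (-α + 0) ≤ -α)
    have : (fun R u => b (u / (2 * B * R)) * b (u / (2 * B * R)) * ((u + 0) ^ (-α) * g u)) =
        fam b g α B := by
      funext R u
      simp only [fam, add_zero]
      ring
    rw [← this]
    exact h4
  obtain ⟨C, hC, hCb⟩ := hfam.Dop_iter (by linarith) (by linarith) hη.le N 0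
  set K : ℝ := 2 * B ^ 2 + N + m + 5 with hK
  refine ⟨C * K ^ (m + 2), by positivity, fun R hR hRN θ => ?_⟩
  have hR0 : 0 < R := by linarith
  set L : ℕ := ⌈B * (2 * B * R)⌉₊ + N + 1 with hL
  have hLlt : B * (2 * B * R) + N < L := by
    have := Nat.le_ceil (B * (2 * B * R))
    rw [hL]; push_cast; linarith
  have hLle : (L : ℝ) + m + 3 ≤ K * R := by
    have := Nat.ceil_lt_add_one (show 0 ≤ B * (2 * B * R) by positivity)
    have h2 : (N + m + 5 : ℝ) ≤ (N + m + 5 : ℝ) * R := by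
      have : (0 : ℝ) ≤ N + m + 5 := by positivity
      nlinarith
    rw [hL, hK]; push_cast; nlinarith
  rw [show ⌈B * (2 * B * R)⌉₊ + N + 2 = L + 1 by omega,
    sum_Dop_iter _ _ hη _ _ (fam_zero_of_gt hB hR hbsupp) N L hLlt]
  have hterm : ∀ l : ℕ, |(Dop (etaD (m + 2)))^[N] (fam b g α B R) l| ≤
      C * R ^ (-α - 2 * (1 - β) * N) := by
    intro l
    rcases lt_or_ge (l : ℝ) (R + N) with h | h
    · rw [Dop_iter_zero_of_lt (fam_zero_of_lt hB hR hbsupp) N l (by linarith)]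
      rw [abs_zero]; positivity
    · simpa using hCb R hR l h
  calc _ ≤ ∑ l ∈ Finset.range (L + 1), C * R ^ (-α - 2 * (1 - β) * N) * (K * R) ^ (m + 1) := by
        refine Finset.sum_le_sum fun l hl => ?_
        have hl' : (l : ℝ) ≤ L := by
          have := Finset.mem_range.1 hl
          exact_mod_cast (by omega : l ≤ L)
        refine (le_abs_self _).trans ?_
        rw [mul_assoc, abs_mul, abs_mul, abs_of_nonneg (by positivity : 0 ≤ (l : ℝ) + etaD (m + 2))]
        have h1 := (gegen_abs_le hη.le l θ).trans (gegen_one_le m l)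
        have h2 : ((l : ℝ) + m) ^ m ≤ (K * R) ^ m := by
          gcongr
          linarith
        have h3 : (l : ℝ) + etaD (m + 2) ≤ K * R := by linarith
        have hKR : 0 ≤ K * R := by positivity
        rw [pow_succ']
        exact mul_le_mul (hterm l) (mul_le_mul h3 (h1.trans h2) (abs_nonneg _) hKR)
          (by positivity) (by positivity)
    _ = ((L : ℝ) + 1) * (C * R ^ (-α - 2 * (1 - β) * N) * (K * R) ^ (m + 1)) := by
        rw [Finset.sum_const, Finset.card_range, nsmul_eq_mul]; push_cast; ring
    _ ≤ (K * R) * (C * R ^ (-α - 2 * (1 - β) * N) * (K * R) ^ (m + 1)) := by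
        gcongr
        have : (0 : ℝ) ≤ m := by positivity
        linarith
    _ = _ := by ring

theorem lower_bound {m : ℕ} {B : ℝ} (hB : 1 < B) {b g : ℝ → ℝ} {g₁ g₂ : ℝ} {α : ℝ}
    (hbC : ContDiff ℝ (⊤ : ℕ∞) b) (hb1 : b 1 = 1)
    (hα : 2 < α) (hg12 : 0 < g₁)
    (hgpos : ∀ u : ℝ, 0 < u → g₁ ≤ g u ∧ g u ≤ g₂) (N : ℕ) :
    ∃ c : ℝ, 0 < c ∧ ∃ R₀ : ℝ, ∀ R : ℝ, 1 ≤ R → R₀ ≤ R →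
      c * (R ^ (-α) * R ^ (m + 2)) ≤ ∑ l ∈ Finset.range (⌈B * (2 * B * R)⌉₊ + N + 2),
        fam b g α B R l * ((l : ℝ) + etaD (m + 2)) * gegen (etaD (m + 2)) l 1 := by
  have hB0 : 0 < B := by linarith
  have hη : 0 < etaD (m + 2) := by
    simp only [etaD]; push_cast; have : (0 : ℝ) ≤ m := by positivity
    linarith
  have hG : ∀ l : ℕ, 0 ≤ gegen (etaD (m + 2)) l 1 := fun l =>
    le_trans (by positivity) (le_gegen_one m l)
  obtain ⟨δ, hδ, hδb⟩ : ∃ δ : ℝ, 0 < δ ∧ ∀ u, 1 ≤ u → u ≤ 1 + δ → 1 / 2 ≤ b u := by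
    have hc : ContinuousAt b 1 := hbC.continuous.continuousAt
    obtain ⟨δ, hδ, h⟩ := Metric.continuousAt_iff.1 hc (1 / 2) (by norm_num)
    refine ⟨δ / 2, by positivity, fun u h1 h2 => ?_⟩
    have h3 := h (x := u) (by rw [Real.dist_eq, abs_of_nonneg (by linarith)]; linarith)
    rw [Real.dist_eq, hb1, abs_lt] at h3
    linarith
  set ε : ℝ := min δ (B - 1) with hε
  have hε0 : 0 < ε := lt_min hδ (by linarith)
  have hεδ : ε ≤ δ := min_le_left _ _
  have hεB : ε ≤ B - 1 := min_le_right _ _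
  refine ⟨ε / 2 * (1 / 4 * B ^ (-α) * g₁ / m.factorial) * (2 * B) ^ (-α) * (2 * B) ^ (m + 2),
    by positivity, 2 / ε, fun R hR hR2 => ?_⟩
  have hR0 : 0 < R := by linarith
  set P : ℝ := 2 * B * R with hP
  have hP0 : 0 < P := by positivity
  have hεP : 2 ≤ ε * P := by
    rw [div_le_iff₀ hε0] at hR2
    have : 1 ≤ 2 * B := by linarith
    calc (2 : ℝ) ≤ R * ε := hR2
      _ ≤ (2 * B) * (R * ε) := by nlinarith [mul_pos hR0 hε0]
      _ = ε * P := by rw [hP]; ring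
  set S := Finset.Icc ⌈P⌉₊ ⌊(1 + ε) * P⌋₊ with hS
  have hsub : S ⊆ Finset.range (⌈B * P⌉₊ + N + 2) := by
    intro l hl
    rw [hS, Finset.mem_Icc] at hl
    rw [Finset.mem_range]
    have h1 : ⌊(1 + ε) * P⌋₊ ≤ ⌊B * P⌋₊ := Nat.floor_le_floor (by nlinarith)
    have h2 := Nat.floor_le_ceil (B * P)
    omega
  have hcard : ε / 2 * P ≤ (S.card : ℝ) := by
    rw [hS, Nat.card_Icc]
    have h1 := Nat.ceil_lt_add_one hP0.le
    have h2 := Nat.lt_floor_add_one ((1 + ε) * P)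
    have h3 : ((⌊(1 + ε) * P⌋₊ + 1 : ℕ) : ℝ) - (⌈P⌉₊ : ℕ) ≤
        ((⌊(1 + ε) * P⌋₊ + 1 - ⌈P⌉₊ : ℕ) : ℝ) := by
      rw [sub_le_iff_le_add]
      exact_mod_cast (by omega)
    push_cast at h3
    linarith
  have hnn : ∀ l : ℕ, 0 ≤ fam b g α B R l * ((l : ℝ) + etaD (m + 2)) *
      gegen (etaD (m + 2)) l 1 := by
    intro l
    have hf : 0 ≤ fam b g α B R l := by
      unfold fam
      rcases Nat.eq_zero_or_pos l with rfl | hl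
      · rw [Nat.cast_zero, Real.zero_rpow (by linarith)]; simp
      · have := (hgpos l (by exact_mod_cast hl)).1
        have : 0 ≤ g l := by linarith
        positivity
    exact mul_nonneg (mul_nonneg hf (by positivity)) (hG l)
  have hterm : ∀ l ∈ S, 1 / 4 * B ^ (-α) * g₁ / m.factorial * P ^ (-α) * P ^ (m + 1) ≤
      fam b g α B R l * ((l : ℝ) + etaD (m + 2)) * gegen (etaD (m + 2)) l 1 := by
    intro l hl
    rw [hS, Finset.mem_Icc] at hl
    have hl1 : P ≤ l := Nat.ceil_le.1 hl.1
    have hl2 : (l : ℝ) ≤ (1 + ε) * P := (Nat.le_floor_iff (by positivity)).1 hl.2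
    have hl0 : (0 : ℝ) < l := by linarith
    have hb : 1 / 2 ≤ b (l / P) := by
      apply hδb
      · rw [le_div_iff₀ hP0]; linarith
      · rw [div_le_iff₀ hP0]; nlinarith
    have hb' : 1 / 4 ≤ b (l / P) ^ 2 := by nlinarith
    have hg' := (hgpos l hl0).1
    have hpow : B ^ (-α) * P ^ (-α) ≤ (l : ℝ) ^ (-α) := by
      rw [← Real.mul_rpow hB0.le hP0.le]
      apply Real.rpow_le_rpow_of_nonpos hl0 _ (by linarith)
      nlinarith
    have hfm : 1 / 4 * ((B ^ (-α) * P ^ (-α)) * g₁) ≤ fam b g α B R l := by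
      unfold fam
      rw [← hP]
      gcongr
    have hGl : P ^ m / m.factorial ≤ gegen (etaD (m + 2)) l 1 := by
      refine le_trans ?_ (le_gegen_one m l)
      gcongr
    have hPl : P ≤ (l : ℝ) + etaD (m + 2) := by linarith
    calc _ = (1 / 4 * ((B ^ (-α) * P ^ (-α)) * g₁)) * P * (P ^ m / m.factorial) := by
          rw [pow_succ]; ring
      _ ≤ _ := by
          have h0 : 0 ≤ 1 / 4 * ((B ^ (-α) * P ^ (-α)) * g₁) := by positivity
          have h1 := h0.trans hfm
          gcongr
  calc _ = (ε / 2 * P) * (1 / 4 * B ^ (-α) * g₁ / m.factorial * P ^ (-α) * P ^ (m + 1)) := by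
        rw [hP, Real.mul_rpow (by positivity : 0 ≤ 2 * B) hR0.le, mul_pow]; ring
    _ ≤ S.card * (1 / 4 * B ^ (-α) * g₁ / m.factorial * P ^ (-α) * P ^ (m + 1)) := by
        gcongr
    _ ≤ ∑ l ∈ S, fam b g α B R l * ((l : ℝ) + etaD (m + 2)) * gegen (etaD (m + 2)) l 1 := by
        rw [← nsmul_eq_mul]
        exact Finset.card_nsmul_le_sum _ _ _ hterm
    _ ≤ _ := Finset.sum_le_sum_of_subset_of_nonneg hsub fun l _ _ => hnn l

theorem one_sub_cos_ge {θ : ℝ} (h0 : 0 < θ) (h1 : θ ≤ Real.pi) :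
    θ ^ 2 ≤ Real.pi ^ 2 / 2 * (1 - Real.cos θ) := by
  have h2 := Real.mul_le_sin (x := θ / 2) (by linarith) (by linarith)
  have h3 : Real.cos θ = 1 - 2 * Real.sin (θ / 2) ^ 2 := by
    have := Real.cos_sq' (θ / 2)
    have h := Real.cos_two_mul (θ / 2)
    rw [show 2 * (θ / 2) = θ by ring] at h
    linarith
  have hpi := Real.pi_pos
  have h4 : θ ≤ Real.pi * Real.sin (θ / 2) := by
    calc θ = Real.pi * (2 / Real.pi * (θ / 2)) := by field_simp
      _ ≤ _ := by gcongr
  rw [h3]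
  have := mul_self_le_mul_self h0.le h4
  nlinarith

/-- **Uncorrelation of standard needlet coefficients.**
For standard needlets with parameter `B > 1` and a power spectrum
`C_ℓ = ℓ^{−α} g(ℓ)` satisfying the regularity assumption with `α > 2`, `β ∈ [0,1)`,
for every `N` there are `C_N > 0` and `J` such that for `j ≥ J` and `θ ∈ (0, π]`,
`Φ_j(cos θ)/Φ_j(1) ≤ C_N/(B^{(j−1)(1−β)} θ)^{2N}`. -/
theorem standard_needlet_uncorrelation
    (d : ℕ) (hd : 2 ≤ d) (B : ℝ) (hB : 1 < B) (b : ℝ → ℝ)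
    (Cl : ℕ → ℝ) (g : ℝ → ℝ) (g₁ g₂ : ℝ) (A : ℕ → ℝ) (α β : ℝ)
    -- standard needlet weight function
    (hbC : ContDiff ℝ (⊤ : ℕ∞) b)
    (hb01 : ∀ u : ℝ, 0 ≤ u → b u ∈ Set.Icc (0 : ℝ) 1)
    (hbsupp : ∀ u : ℝ, u ∉ Set.Icc (1 / B) B → b u = 0)
    (hb1 : b 1 = 1)
    (hbpart : ∀ u : ℝ, 1 ≤ u → ∑' j : ℕ, (b (u / B ^ j)) ^ 2 = 1)
    -- power spectrum regularity assumption
    (hα : 2 < α) (hβ0 : 0 ≤ β) (hβ1 : β < 1)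
    (hg12 : 0 < g₁) (hg21 : g₁ ≤ g₂)
    (hgC : ContDiffOn ℝ (⊤ : ℕ∞) g (Set.Ioi 0))
    (hgpos : ∀ u : ℝ, 0 < u → g₁ ≤ g u ∧ g u ≤ g₂)
    (hgder : ∀ r : ℕ, 1 ≤ r → ∀ u : ℝ, 1 ≤ u →
      |iteratedDeriv r g u| ≤ A r * u ^ (-(1 - β) * (r : ℝ)))
    (hCl : ∀ ℓ : ℕ, 1 ≤ ℓ → Cl ℓ = (ℓ : ℝ) ^ (-α) * g ℓ) :
    ∀ N : ℕ, ∃ C : ℝ, 0 < C ∧ ∃ J : ℕ,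
      ∀ j : ℕ, J ≤ j → ∀ θ : ℝ, 0 < θ → θ ≤ Real.pi →
        (∑' ℓ : ℕ, (b ((ℓ : ℝ) / B ^ j)) ^ 2 * Cl ℓ * Zker d ℓ (Real.cos θ)) /
            (∑' ℓ : ℕ, (b ((ℓ : ℝ) / B ^ j)) ^ 2 * Cl ℓ * Zker d ℓ 1) ≤
          C / (B ^ (((j : ℝ) - 1) * (1 - β)) * θ) ^ (2 * N) := by
  intro N
  obtain ⟨m, rfl⟩ : ∃ m, d = m + 2 := ⟨d - 2, by omega⟩
  obtain ⟨C₁, hC₁, hup⟩ := upper_bound (m := m) hB hbC hbsupp hα hβ0 hβ1 hg12 hgC hgpos hgder N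
  obtain ⟨c, hc, R₀, hlow⟩ := lower_bound (m := m) hB hbC hb1 hα hg12 hgpos N
  have hB0 : 0 < B := by linarith
  have hpi := Real.pi_pos
  refine ⟨C₁ / c * ((2 : ℝ) ^ (1 - β)) ^ (2 * N) * (Real.pi ^ 2 / 2) ^ N + 1, by positivity, ?_⟩
  have hev : ∀ᶠ j : ℕ in Filter.atTop, 2 * B * (max (max 1 (2 * (N : ℝ))) R₀) ≤ B ^ j :=
    (tendsto_pow_atTop_atTop_of_one_lt hB).eventually_ge_atTop _
  obtain ⟨J, hJ⟩ := Filter.eventually_atTop.1 hev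
  refine ⟨J, fun j hj θ hθ0 hθπ => ?_⟩
  set R : ℝ := B ^ j / (2 * B) with hR
  have hRP : 2 * B * R = B ^ j := by rw [hR]; field_simp
  have hRmax : max (max 1 (2 * (N : ℝ))) R₀ ≤ R := by
    rw [hR, le_div_iff₀ (by positivity)]
    linarith [hJ j hj]
  have hR1 : 1 ≤ R := (le_max_left _ _).trans ((le_max_left _ _).trans hRmax)
  have hRN : 2 * (N : ℝ) ≤ R := (le_max_right _ _).trans ((le_max_left _ _).trans hRmax)
  have hRR : R₀ ≤ R := (le_max_right _ _).trans hRmax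
  have hR0 : 0 < R := by linarith
  set L : ℕ := ⌈B * (2 * B * R)⌉₊ + N + 2 with hL
  have hη : 0 < etaD (m + 2) := by
    simp only [etaD]; push_cast; have : (0 : ℝ) ≤ m := by positivity
    linarith
  have hω : 0 < omegaD (m + 2) := by
    have : 0 < Real.Gamma ((((m + 2 : ℕ) : ℝ) + 1) / 2) := Real.Gamma_pos_of_pos (by positivity)
    unfold omegaD
    positivity
  -- the series are finite sums
  have hsum : ∀ t : ℝ, ∑' ℓ : ℕ, (b ((ℓ : ℝ) / B ^ j)) ^ 2 * Cl ℓ * Zker (m + 2) ℓ t =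
      (1 / (etaD (m + 2) * omegaD (m + 2))) * ∑ l ∈ Finset.range L,
        fam b g α B R l * ((l : ℝ) + etaD (m + 2)) * gegen (etaD (m + 2)) l t := by
    intro t
    have hterm : ∀ l : ℕ, (b ((l : ℝ) / B ^ j)) ^ 2 * Cl l * Zker (m + 2) l t =
        (1 / (etaD (m + 2) * omegaD (m + 2))) * (fam b g α B R l * ((l : ℝ) + etaD (m + 2)) *
          gegen (etaD (m + 2)) l t) := by
      intro l
      have hf : (b ((l : ℝ) / B ^ j)) ^ 2 * Cl l = fam b g α B R l := by
        rcases Nat.eq_zero_or_pos l with rfl | hl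
        · have h0 : b 0 = 0 := hbsupp 0 (by
            rintro ⟨h, -⟩
            have : 0 < 1 / B := by positivity
            linarith)
          simp [fam, h0]
        · rw [hCl l hl, fam, hRP]
      rw [hf, Zker]
      ring
    rw [Finset.mul_sum, tsum_eq_sum (s := Finset.range L)]
    · exact Finset.sum_congr rfl fun l _ => hterm l
    · intro l hl
      have hl' : L ≤ l := by simpa using hl
      have h1 := Nat.le_ceil (B * (2 * B * R))
      have h2 : (L : ℝ) ≤ l := by exact_mod_cast hl'
      rw [hterm, fam_zero_of_gt hB hR1 hbsupp l]
      · ring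
      · rw [hL] at h2
        push_cast at h2
        have : (0 : ℝ) ≤ N := by positivity
        linarith
  rw [hsum, hsum, mul_div_mul_left _ _ (by positivity)]
  have hX := hup R hR1 hRN θ
  have hY := hlow R hR1 hRR
  rw [← hL] at hX hY
  set X := ∑ l ∈ Finset.range L,
    fam b g α B R l * ((l : ℝ) + etaD (m + 2)) * gegen (etaD (m + 2)) l (Real.cos θ)
  set Y := ∑ l ∈ Finset.range L,
    fam b g α B R l * ((l : ℝ) + etaD (m + 2)) * gegen (etaD (m + 2)) l 1
  have hden : (B ^ (((j : ℝ) - 1) * (1 - β)) * θ) =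
      ((2 : ℝ) ^ (1 - β)) * R ^ (1 - β) * θ := by
    rw [← Real.mul_rpow (by norm_num) hR0.le, Real.rpow_mul hB0.le, Real.rpow_sub hB0,
      Real.rpow_natCast, Real.rpow_one]
    congr 2
    rw [hR]; field_simp
  have hcos := one_sub_cos_ge hθ0 hθπ
  have hD : (((2 : ℝ) ^ (1 - β)) * R ^ (1 - β) * θ) ^ (2 * N) ≤
      ((2 : ℝ) ^ (1 - β)) ^ (2 * N) * (R ^ (2 * (1 - β) * N)) *
        ((Real.pi ^ 2 / 2) ^ N * (1 - Real.cos θ) ^ N) := by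
    rw [mul_pow, mul_pow, ← mul_pow (Real.pi ^ 2 / 2), pow_mul θ]
    have h1 : (R ^ (1 - β)) ^ (2 * N) = R ^ (2 * (1 - β) * N) := by
      rw [← Real.rpow_natCast, ← Real.rpow_mul hR0.le]
      push_cast
      ring_nf
    rw [h1]
    gcongr
  have hY0 : 0 < Y := lt_of_lt_of_le (by positivity) hY
  have hDpos : 0 < (((2 : ℝ) ^ (1 - β)) * R ^ (1 - β) * θ) ^ (2 * N) := by positivity
  rw [hden, le_div_iff₀ hDpos]
  rcases le_or_gt X 0 with hX0 | hX0
  · have : X / Y ≤ 0 := div_nonpos_of_nonpos_of_nonneg hX0 hY0.le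
    have h2 := mul_nonpos_of_nonpos_of_nonneg this hDpos.le
    refine h2.trans (by positivity)
  · rw [div_mul_eq_mul_div, div_le_iff₀ hY0]
    have hRe : R ^ (2 * (1 - β) * N) * R ^ (-α - 2 * (1 - β) * N) = R ^ (-α) := by
      rw [← Real.rpow_add hR0]; ring_nf
    set Q := ((2 : ℝ) ^ (1 - β)) ^ (2 * N) with hQ
    have hQ0 : 0 < Q := by positivity
    calc _ ≤ X * (Q * (R ^ (2 * (1 - β) * N)) *
        ((Real.pi ^ 2 / 2) ^ N * (1 - Real.cos θ) ^ N)) := by gcongr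
      _ = (Q * (R ^ (2 * (1 - β) * N)) * (Real.pi ^ 2 / 2) ^ N) *
          ((1 - Real.cos θ) ^ N * X) := by ring
      _ ≤ (Q * (R ^ (2 * (1 - β) * N)) * (Real.pi ^ 2 / 2) ^ N) *
          (C₁ * (R ^ (-α - 2 * (1 - β) * N) * R ^ (m + 2))) := by gcongr
      _ = C₁ * Q * (Real.pi ^ 2 / 2) ^ N *
          ((R ^ (2 * (1 - β) * N) * R ^ (-α - 2 * (1 - β) * N)) * R ^ (m + 2)) := by ring
      _ = C₁ / c * Q * (Real.pi ^ 2 / 2) ^ N * (c * (R ^ (-α) * R ^ (m + 2))) := by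
          rw [hRe]; field_simp
      _ ≤ C₁ / c * Q * (Real.pi ^ 2 / 2) ^ N * Y := by gcongr
      _ ≤ _ := by
          gcongr
          linarith
end
end

section
/- Let d ≥ 2 be an integer and (r_ℓ)_{ℓ≥0} a finitely supported real sequence, with the convention r_{−1} = 0. Define q(x) = Σ_{ℓ ≥ 0} r_ℓ Z_{ℓ;d}(x). Then for every N ∈ ℕ and every x ∈ [−1, 1], (x − 1)^N q(x) = Σ_{ℓ ≥ 0} (Υ_d^N r)_ℓ Z_{ℓ;d}(x), where Υ_d denotes the operator on sequences given by (Υ_d r)_ℓ = υ_{1;d}(ℓ)(Δ⁻Δ⁺ r)_ℓ + υ_{0;d}(ℓ)(Δ⁺ r)_ℓ, and Υ_d^N is its N-fold iterate. -/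
noncomputable section

/-- Forward difference `(Δ⁺ r)_ℓ = r_{ℓ+1} − r_ℓ`. -/
def deltaPlus (r : ℕ → ℝ) : ℕ → ℝ := fun ℓ => r (ℓ + 1) - r ℓ

/-- Backward difference `(Δ⁻ r)_ℓ = r_ℓ − r_{ℓ−1}`, with the convention `r_{−1} = 0`. -/
def deltaMinus (r : ℕ → ℝ) : ℕ → ℝ :=
  fun ℓ => r ℓ - (if ℓ = 0 then 0 else r (ℓ - 1))

/-- The operator `Υ_d`, `(Υ_d r)_ℓ = υ_{1;d}(ℓ) (Δ⁻Δ⁺ r)_ℓ + υ_{0;d}(ℓ) (Δ⁺ r)_ℓ`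
with `υ_{1;d}(ℓ) = ℓ/(2(ℓ+η_d))` and `υ_{0;d}(ℓ) = 2η_d/(2(ℓ+η_d))`. -/
def upsilon (d : ℕ) (r : ℕ → ℝ) : ℕ → ℝ :=
  fun ℓ =>
    ((ℓ : ℝ) / (2 * ((ℓ : ℝ) + etaD d))) * deltaMinus (deltaPlus r) ℓ
      + ((2 * etaD d) / (2 * ((ℓ : ℝ) + etaD d))) * deltaPlus r ℓ

lemma upsilon_zero_mul (d : ℕ) (hη : 0 < etaD d) (r : ℕ → ℝ) :
    upsilon d r 0 * etaD d = etaD d * r 1 - etaD d * r 0 := by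
  simp only [upsilon, deltaMinus, deltaPlus]
  simp
  field_simp

lemma upsilon_succ_mul (d : ℕ) (hη : 0 < etaD d) (r : ℕ → ℝ) (n : ℕ) :
    upsilon d r (n + 1) * ((n : ℝ) + 1 + etaD d) =
      (((n : ℝ) + 1) / 2 + etaD d) * r (n + 2) - ((n : ℝ) + 1 + etaD d) * r (n + 1)
        + ((n : ℝ) + 1) / 2 * r n := by
  have h : (n : ℝ) + 1 + etaD d ≠ 0 := by positivity
  simp only [upsilon, deltaMinus, deltaPlus, Nat.succ_ne_zero, if_false, Nat.add_sub_cancel]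
  push_cast
  field_simp
  ring

lemma gegen_rec (η : ℝ) (n : ℕ) (x : ℝ) :
    ((n : ℝ) + 2) * gegen η (n + 2) x = 2 * ((n : ℝ) + 1 + η) * x * gegen η (n + 1) x
        - ((n : ℝ) + 1 + 2 * η - 1) * gegen η n x := by
  have h : (n : ℝ) + 2 ≠ 0 := by positivity
  rw [gegen]
  field_simp

lemma partial_sum (d : ℕ) (hη : 0 < etaD d) (r : ℕ → ℝ) (x : ℝ) (n : ℕ) :
    ∑ l ∈ Finset.range (n + 1),
      (upsilon d r l - (x - 1) * r l) * (((l : ℝ) + etaD d) * gegen (etaD d) l x) =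
    ((n : ℝ) / 2 + etaD d) * r (n + 1) * gegen (etaD d) n x
      - ((n : ℝ) + 1) / 2 * r n * gegen (etaD d) (n + 1) x := by
  induction n with
  | zero =>
    have h := upsilon_zero_mul d hη r
    simp [gegen]
    linear_combination h
  | succ n ih =>
    rw [Finset.sum_range_succ, ih]
    have h := upsilon_succ_mul d hη r n
    have g := gegen_rec (etaD d) n x
    push_cast
    linear_combination gegen (etaD d) (n + 1) x * h + r (n + 1) / 2 * g

lemma upsilon_support (d : ℕ) (r : ℕ → ℝ) (L : ℕ) (hL : ∀ l, L ≤ l → r l = 0) :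
    ∀ l, L + 1 ≤ l → upsilon d r l = 0 := by
  intro l hl
  obtain ⟨m, rfl⟩ : ∃ m, l = m + 1 := ⟨l - 1, by omega⟩
  simp [upsilon, deltaMinus, deltaPlus, hL m (by omega), hL (m + 1) (by omega),
    hL (m + 1 + 1) (by omega)]

lemma one_step (d : ℕ) (hη : 0 < etaD d) (r : ℕ → ℝ) (L : ℕ) (hL : ∀ l, L ≤ l → r l = 0)
    (x : ℝ) :
    (x - 1) * ∑' l : ℕ, r l * Zker d l x = ∑' l : ℕ, upsilon d r l * Zker d l x := by
  rw [tsum_eq_sum (s := Finset.range (L + 1)), tsum_eq_sum (s := Finset.range (L + 1))]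
  · have h := partial_sum d hη r x L
    rw [hL L le_rfl, hL (L + 1) (by omega)] at h
    simp only [mul_zero, zero_mul, sub_zero] at h
    rw [← sub_eq_zero, Finset.mul_sum, ← Finset.sum_sub_distrib]
    have h2 := congrArg (fun t => -(1 / (etaD d * omegaD d)) * t) h
    simp only [mul_zero, Finset.mul_sum] at h2
    rw [← h2]
    refine Finset.sum_congr rfl fun l _ => ?_
    rw [Zker]
    ring
  · intro l hl
    rw [upsilon_support d r L hL l (by simpa using hl), zero_mul]
  · intro l hl
    rw [hL l (by simp at hl; omega), zero_mul]

/-- **Gegenbauer expansion of `(x−1)^N q(x)`.**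
For a finitely supported sequence `r` and `q(x) = Σ_ℓ r_ℓ Z_{ℓ;d}(x)`, for every `N`
and every `x ∈ [−1,1]`, `(x − 1)^N q(x) = Σ_ℓ (Υ_d^N r)_ℓ Z_{ℓ;d}(x)`. -/
theorem gegenbauer_difference_expansion
    (d : ℕ) (hd : 2 ≤ d) (r : ℕ → ℝ) (hr : ∃ L : ℕ, ∀ ℓ : ℕ, L ≤ ℓ → r ℓ = 0) :
    ∀ N : ℕ, ∀ x : ℝ, -1 ≤ x → x ≤ 1 →
      (x - 1) ^ N * ∑' ℓ : ℕ, r ℓ * Zker d ℓ x =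
        ∑' ℓ : ℕ, ((upsilon d)^[N] r) ℓ * Zker d ℓ x := by
  have hη : 0 < etaD d := by
    have : (2 : ℝ) ≤ d := by exact_mod_cast hd
    unfold etaD
    linarith
  intro N x _ _
  induction N generalizing r with
  | zero => simp
  | succ N ih =>
    obtain ⟨L, hL⟩ := hr
    rw [Function.iterate_succ_apply, ← ih _ ⟨L + 1, upsilon_support d r L hL⟩,
      ← one_step d hη r L hL x]
    ring
end
end

section
/- Let d ≥ 2 be an integer and let b : [0,∞) → ℝ be a C^∞ function all of whose derivatives are bounded. Then for every N ∈ ℕ there exist constants C(0), …, C(2N−1) ≥ 0 and C* ≥ 0, depending only on N and d, such that for every integer ℓ ≥ 1, |Υ_d^N(ℓ) b| ≤ C* · sup_u |b^{(2N)}(u)| + Σ_{i=0}^{2N−1} (C(i)/ℓ^{2N−i}) · sup_u |b^{(i)}(u)|, where Υ_d^N(ℓ) b denotes the N-fold iterate of the operator Υ_d applied to the sequence (b(ℓ))_{ℓ≥0}, evaluated at index ℓ. -/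
noncomputable section

/-- Weight `W_m(ℓ) = ∑_{i ≤ m} S_i / (ℓ+1)^(m-i)`. -/
def wgt (S : ℕ → ℝ) (m ℓ : ℕ) : ℝ :=
  ∑ i ∈ Finset.range (m + 1), S i / ((ℓ : ℝ) + 1) ^ (m - i)

/-- A family of sequences of order `m`, uniformly in the parameter. -/
def OrdW {B : Type} (S : B → ℕ → ℝ) (m : ℕ) (g : B → ℕ → ℝ) : Prop :=
  ∀ k : ℕ, ∃ C : ℝ, 0 ≤ C ∧ ∀ β ℓ, |deltaPlus^[k] (g β) ℓ| ≤ C * wgt (S β) (m + k) ℓ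

/-- Multipliers of order `j`. -/
def MulW (j : ℕ) (p : ℕ → ℝ) : Prop :=
  ∀ k : ℕ, ∃ C : ℝ, 0 ≤ C ∧ ∀ ℓ : ℕ, |deltaPlus^[k] p ℓ| ≤ C / ((ℓ : ℝ) + 1) ^ (j + k)

lemma dp_add (k : ℕ) : ∀ (g h : ℕ → ℝ) (ℓ : ℕ),
    deltaPlus^[k] (fun n => g n + h n) ℓ = deltaPlus^[k] g ℓ + deltaPlus^[k] h ℓ := by
  induction k with
  | zero => intro g h ℓ; rfl
  | succ k ih =>
    intro g h ℓ
    rw [Function.iterate_succ_apply, Function.iterate_succ_apply, Function.iterate_succ_apply,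
      ← ih]
    refine congrFun (congrArg _ ?_) ℓ
    funext n
    simp only [deltaPlus]; ring

lemma dp_smul (k : ℕ) (c : ℝ) : ∀ (g : ℕ → ℝ) (ℓ : ℕ),
    deltaPlus^[k] (fun n => c * g n) ℓ = c * deltaPlus^[k] g ℓ := by
  induction k with
  | zero => intro g ℓ; rfl
  | succ k ih =>
    intro g ℓ
    rw [Function.iterate_succ_apply, Function.iterate_succ_apply, ← ih]
    refine congrFun (congrArg _ ?_) ℓ
    funext n
    simp only [deltaPlus]; ring

lemma dp_shift (k : ℕ) : ∀ (g : ℕ → ℝ) (ℓ : ℕ),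
    deltaPlus^[k] (fun n => g (n + 1)) ℓ = deltaPlus^[k] g (ℓ + 1) := by
  induction k with
  | zero => intro g ℓ; rfl
  | succ k ih =>
    intro g ℓ
    rw [Function.iterate_succ_apply, Function.iterate_succ_apply, ← ih]
    rfl

lemma wgt_nonneg {S : ℕ → ℝ} (hS : ∀ i, 0 ≤ S i) (m ℓ : ℕ) : 0 ≤ wgt S m ℓ := by
  unfold wgt
  exact Finset.sum_nonneg fun i _ => div_nonneg (hS i) (by positivity)

lemma wgt_div {S : ℕ → ℝ} (hS : ∀ i, 0 ≤ S i) (m j ℓ : ℕ) :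
    wgt S m ℓ / ((ℓ : ℝ) + 1) ^ j ≤ wgt S (m + j) ℓ := by
  unfold wgt
  rw [Finset.sum_div]
  have h1 : ∀ i ∈ Finset.range (m + 1), S i / ((ℓ : ℝ) + 1) ^ (m - i) / ((ℓ : ℝ) + 1) ^ j
      = S i / ((ℓ : ℝ) + 1) ^ (m + j - i) := by
    intro i hi
    rw [Finset.mem_range] at hi
    rw [div_div, ← pow_add]
    congr 2; omega
  rw [Finset.sum_congr rfl h1]
  apply Finset.sum_le_sum_of_subset_of_nonneg
  · intro i; simp only [Finset.mem_range]; omega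
  · intro i _ _
    exact div_nonneg (hS i) (by positivity)

lemma wgt_pred {S : ℕ → ℝ} (hS : ∀ i, 0 ≤ S i) (m ℓ : ℕ) :
    wgt S m ℓ ≤ 2 ^ m * wgt S m (ℓ + 1) := by
  unfold wgt
  rw [Finset.mul_sum]
  apply Finset.sum_le_sum
  intro i hi
  have h2 : ((((ℓ + 1 : ℕ) : ℝ)) + 1) ^ (m - i) ≤ 2 ^ m * ((ℓ : ℝ) + 1) ^ (m - i) := by
    calc ((((ℓ + 1 : ℕ) : ℝ)) + 1) ^ (m - i) ≤ (2 * ((ℓ : ℝ) + 1)) ^ (m - i) := by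
          apply pow_le_pow_left₀ (by positivity)
          push_cast
          have : (0 : ℝ) ≤ ℓ := by positivity
          linarith
      _ = 2 ^ (m - i) * ((ℓ : ℝ) + 1) ^ (m - i) := by rw [mul_pow]
      _ ≤ _ := by
          apply mul_le_mul_of_nonneg_right _ (by positivity)
          exact pow_le_pow_right₀ (by norm_num) (by omega)
  rw [← mul_div_assoc, div_le_div_iff₀ (by positivity) (by positivity)]
  calc S i * ((((ℓ + 1 : ℕ) : ℝ)) + 1) ^ (m - i)
      ≤ S i * (2 ^ m * ((ℓ : ℝ) + 1) ^ (m - i)) := mul_le_mul_of_nonneg_left h2 (hS i)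
    _ = _ := by ring

lemma wgt_zero_mono {S : ℕ → ℝ} (hS : ∀ i, 0 ≤ S i) (m : ℕ) :
    wgt S m 0 ≤ wgt S (m + 1) 0 := by
  have := wgt_div hS m 1 0
  simpa using this

section
variable {B : Type} {S : B → ℕ → ℝ}

lemma OrdW.add {m : ℕ} {g h : B → ℕ → ℝ} (hg : OrdW S m g) (hh : OrdW S m h) :
    OrdW S m (fun β n => g β n + h β n) := by
  intro k
  obtain ⟨C, hC, h1⟩ := hg k
  obtain ⟨D, hD, h2⟩ := hh k
  refine ⟨C + D, by positivity, fun β ℓ => ?_⟩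
  rw [dp_add, add_mul]
  exact (abs_add_le _ _).trans (add_le_add (h1 β ℓ) (h2 β ℓ))

lemma OrdW.smul {m : ℕ} {g : B → ℕ → ℝ} (c : ℝ) (hg : OrdW S m g) :
    OrdW S m (fun β n => c * g β n) := by
  intro k
  obtain ⟨C, hC, h1⟩ := hg k
  refine ⟨|c| * C, by positivity, fun β ℓ => ?_⟩
  rw [dp_smul, abs_mul, mul_assoc]
  exact mul_le_mul_of_nonneg_left (h1 β ℓ) (abs_nonneg _)

lemma OrdW.delta {m : ℕ} {g : B → ℕ → ℝ} (hg : OrdW S m g) :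
    OrdW S (m + 1) (fun β => deltaPlus (g β)) := by
  intro k
  obtain ⟨C, hC, h1⟩ := hg (k + 1)
  refine ⟨C, hC, fun β ℓ => ?_⟩
  have := h1 β ℓ
  rw [Function.iterate_succ_apply] at this
  rwa [show m + 1 + k = m + (k + 1) by omega]

lemma MulW.delta {m : ℕ} {g : ℕ → ℝ} (hg : MulW m g) : MulW (m + 1) (deltaPlus g) := by
  intro k
  obtain ⟨C, hC, h1⟩ := hg (k + 1)
  refine ⟨C, hC, fun ℓ => ?_⟩
  have := h1 ℓ
  rw [Function.iterate_succ_apply] at this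
  rwa [show m + 1 + k = m + (k + 1) by omega]

lemma MulW.shift {m : ℕ} {g : ℕ → ℝ} (hg : MulW m g) : MulW m (fun n => g (n + 1)) := by
  intro k
  obtain ⟨C, hC, h1⟩ := hg k
  refine ⟨C, hC, fun ℓ => ?_⟩
  rw [dp_shift]
  refine (h1 (ℓ + 1)).trans ?_
  apply div_le_div_of_nonneg_left hC (by positivity)
  apply pow_le_pow_left₀ (by positivity)
  push_cast; linarith

lemma OrdW.pred (hS : ∀ β i, 0 ≤ S β i) {m : ℕ} {g : B → ℕ → ℝ} (hg : OrdW S m g) :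
    OrdW S m (fun β n => g β (n - 1)) := by
  have key : ∀ (k : ℕ) (β : B) (ℓ : ℕ),
      deltaPlus^[k] (fun n => g β (n - 1)) (ℓ + 1) = deltaPlus^[k] (g β) ℓ := by
    intro k β ℓ
    rw [← dp_shift]
    rfl
  have hz : ∀ k : ℕ, ∃ C : ℝ, 0 ≤ C ∧ ∀ β,
      |deltaPlus^[k] (fun n => g β (n - 1)) 0| ≤ C * wgt (S β) (m + k) 0 := by
    intro k
    induction k with
    | zero =>
      obtain ⟨C, hC, h1⟩ := hg 0
      exact ⟨C, hC, fun β => h1 β 0⟩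
    | succ k ih =>
      obtain ⟨C, hC, h1⟩ := hg k
      obtain ⟨D, hD, h2⟩ := ih
      refine ⟨C + D, by positivity, fun β => ?_⟩
      rw [Function.iterate_succ_apply']
      have e : deltaPlus (deltaPlus^[k] (fun n => g β (n - 1))) 0
        = deltaPlus^[k] (g β) 0 - deltaPlus^[k] (fun n => g β (n - 1)) 0 := by
        rw [← key]; rfl
      rw [e]
      calc _ ≤ |deltaPlus^[k] (g β) 0| + |deltaPlus^[k] (fun n => g β (n - 1)) 0| := abs_sub _ _
        _ ≤ C * wgt (S β) (m + k) 0 + D * wgt (S β) (m + k) 0 := add_le_add (h1 β 0) (h2 β)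
        _ = (C + D) * wgt (S β) (m + k) 0 := by ring
        _ ≤ _ := mul_le_mul_of_nonneg_left (wgt_zero_mono (hS β) (m + k)) (by positivity)
  intro k
  obtain ⟨C, hC, h1⟩ := hg k
  obtain ⟨D, hD, h2⟩ := hz k
  refine ⟨C * 2 ^ (m + k) + D, by positivity, fun β ℓ => ?_⟩
  cases ℓ with
  | zero =>
    refine (h2 β).trans (mul_le_mul_of_nonneg_right ?_ (wgt_nonneg (hS β) _ _))
    have : 0 ≤ C * 2 ^ (m + k) := by positivity
    linarith
  | succ ℓ =>
    rw [key]
    have a1 := h1 β ℓ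
    have a2 := mul_le_mul_of_nonneg_left (wgt_pred (hS β) (m + k) ℓ) hC
    have a3 := mul_nonneg hD (wgt_nonneg (hS β) (m + k) (ℓ + 1))
    linarith

lemma mul_aux (hS : ∀ β i, 0 ≤ S β i) (k : ℕ) : ∀ (j m : ℕ) (p : ℕ → ℝ) (g : B → ℕ → ℝ),
    MulW j p → OrdW S m g → ∃ C : ℝ, 0 ≤ C ∧
      ∀ β ℓ, |deltaPlus^[k] (fun n => p n * g β n) ℓ| ≤ C * wgt (S β) (m + j + k) ℓ := by
  induction k with
  | zero =>
    intro j m p g hp hg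
    obtain ⟨C, hC, h1⟩ := hp 0
    obtain ⟨D, hD, h2⟩ := hg 0
    refine ⟨C * D, by positivity, fun β ℓ => ?_⟩
    have a1 := h1 ℓ
    have a2 := h2 β ℓ
    simp only [Function.iterate_zero, id, add_zero] at a1 a2 ⊢
    rw [abs_mul]
    calc |p ℓ| * |g β ℓ| ≤ (C / ((ℓ : ℝ) + 1) ^ j) * (D * wgt (S β) m ℓ) :=
          mul_le_mul a1 a2 (abs_nonneg _) (by positivity)
      _ = C * D * (wgt (S β) m ℓ / ((ℓ : ℝ) + 1) ^ j) := by ring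
      _ ≤ _ := mul_le_mul_of_nonneg_left (wgt_div (hS β) m j ℓ) (by positivity)
  | succ k ih =>
    intro j m p g hp hg
    obtain ⟨C, hC, h1⟩ := ih j (m + 1) _ _ hp.shift hg.delta
    obtain ⟨D, hD, h2⟩ := ih (j + 1) m _ _ hp.delta hg
    refine ⟨C + D, by positivity, fun β ℓ => ?_⟩
    rw [Function.iterate_succ_apply]
    have e : deltaPlus (fun n => p n * g β n)
        = fun n => p (n + 1) * deltaPlus (g β) n + deltaPlus p n * g β n := by
      funext n; simp only [deltaPlus]; ring
    rw [e, dp_add, add_mul]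
    have a1 := h1 β ℓ
    have a2 := h2 β ℓ
    rw [show m + 1 + j + k = m + j + (k + 1) by omega] at a1
    rw [show m + (j + 1) + k = m + j + (k + 1) by omega] at a2
    exact (abs_add_le _ _).trans (add_le_add a1 a2)

lemma q_formula (η : ℝ) (hη : 0 < η) (k : ℕ) : ∀ ℓ : ℕ,
    deltaPlus^[k] (fun n : ℕ => 1 / ((n : ℝ) + η)) ℓ
      = (-1) ^ k * (k.factorial : ℝ) / ∏ i ∈ Finset.range (k + 1), ((ℓ : ℝ) + η + i) := by
  induction k with
  | zero => intro ℓ; simp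
  | succ k ih =>
    intro ℓ
    rw [Function.iterate_succ_apply']
    change deltaPlus^[k] (fun n : ℕ => 1 / ((n : ℝ) + η)) (ℓ + 1) -
      deltaPlus^[k] (fun n : ℕ => 1 / ((n : ℝ) + η)) ℓ = _
    rw [ih, ih, Finset.prod_range_succ, Finset.prod_range_succ' _ k,
      Finset.prod_range_succ' _ (k + 1), Finset.prod_range_succ]
    have e : ∀ i : ℕ, (((ℓ + 1 : ℕ) : ℝ) + η + i) = (ℓ : ℝ) + η + ((i + 1 : ℕ) : ℝ) := by
      intro i; push_cast; ring
    simp only [e]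
    have hP : (∏ i ∈ Finset.range k, ((ℓ : ℝ) + η + ((i + 1 : ℕ) : ℝ))) ≠ 0 := by
      apply Finset.prod_ne_zero_iff.mpr
      intro i _; positivity
    generalize (∏ i ∈ Finset.range k, ((ℓ : ℝ) + η + ((i + 1 : ℕ) : ℝ))) = P at hP
    have h1 : (ℓ : ℝ) + η + ((k + 1 : ℕ) : ℝ) ≠ 0 := by positivity
    have h2 : (ℓ : ℝ) + η + ((0 : ℕ) : ℝ) ≠ 0 := by positivity
    rw [Nat.factorial_succ]
    rw [div_sub_div _ _ (by positivity) (by positivity), div_eq_div_iff (by positivity) (by positivity)]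
    push_cast
    ring

lemma q_mul (η : ℝ) (hη : 1 / 2 ≤ η) : MulW 1 (fun n : ℕ => 1 / ((n : ℝ) + η)) := by
  intro k
  refine ⟨k.factorial * 2 ^ (k + 1), by positivity, fun ℓ => ?_⟩
  have h0 : (0 : ℝ) < η := by linarith
  have hl : (0 : ℝ) ≤ ℓ := by positivity
  rw [q_formula η h0]
  have hP : (((ℓ : ℝ) + 1) / 2) ^ (k + 1) ≤ ∏ i ∈ Finset.range (k + 1), ((ℓ : ℝ) + η + i) := by
    have : (((ℓ : ℝ) + 1) / 2) ^ (k + 1) = ∏ i ∈ Finset.range (k + 1), (((ℓ : ℝ) + 1) / 2) := by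
      rw [Finset.prod_const, Finset.card_range]
    rw [this]
    apply Finset.prod_le_prod
    · intro i _; positivity
    · intro i _
      have : (0 : ℝ) ≤ i := by positivity
      linarith
  have hpos : (0 : ℝ) < (((ℓ : ℝ) + 1) / 2) ^ (k + 1) := by positivity
  rw [abs_div, abs_mul, abs_pow, abs_neg, abs_one, one_pow, one_mul, Nat.abs_cast,
    abs_of_pos (hpos.trans_le hP)]
  calc _ ≤ (k.factorial : ℝ) / (((ℓ : ℝ) + 1) / 2) ^ (k + 1) :=
        div_le_div_of_nonneg_left (by positivity) hpos hP
    _ = _ := by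
        rw [div_pow, add_comm 1 k]
        field_simp

lemma upsilon_eq (d : ℕ) (hd : 2 ≤ d) (r : ℕ → ℝ) :
    upsilon d r = fun n => (1 / 2) * deltaPlus (deltaPlus r) (n - 1) +
      etaD d * (1 / ((n : ℝ) + etaD d) *
        (deltaPlus r n + (-1 / 2) * deltaPlus (deltaPlus r) (n - 1))) := by
  have hη : 0 < etaD d := by
    unfold etaD
    have : (2 : ℝ) ≤ d := by exact_mod_cast hd
    linarith
  funext n
  have hn : (n : ℝ) + etaD d ≠ 0 := by positivity
  cases n with
  | zero =>
    simp only [upsilon, deltaMinus, deltaPlus]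
    field_simp
    push_cast
    ring
  | succ n =>
    simp only [upsilon, deltaMinus, deltaPlus]
    simp only [Nat.add_sub_cancel, Nat.succ_ne_zero, if_false]
    field_simp
    ring

lemma OrdW.upsilon (d : ℕ) (hd : 2 ≤ d) (hS : ∀ β i, 0 ≤ S β i) {m : ℕ} {g : B → ℕ → ℝ}
    (hg : OrdW S m g) : OrdW S (m + 2) (fun β => upsilon d (g β)) := by
  have hη : 1 / 2 ≤ etaD d := by
    unfold etaD
    have : (2 : ℝ) ≤ d := by exact_mod_cast hd
    linarith
  have h2 : OrdW S (m + 2) (fun β n => deltaPlus (deltaPlus (g β)) (n - 1)) :=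
    OrdW.pred hS hg.delta.delta
  have h1 : OrdW S (m + 2) (fun β n => 1 / ((n : ℝ) + etaD d) * deltaPlus (g β) n) :=
    fun k => mul_aux hS k 1 (m + 1) _ _ (q_mul _ hη) hg.delta
  -- the multiplier times the second difference: treat `q` as a multiplier of order zero
  have q0 : MulW 0 (fun n : ℕ => 1 / ((n : ℝ) + etaD d)) := by
    intro k
    obtain ⟨C, hC, h⟩ := q_mul _ hη k
    refine ⟨C, hC, fun ℓ => (h ℓ).trans ?_⟩
    apply div_le_div_of_nonneg_left hC (by positivity)
    apply pow_le_pow_right₀ _ (by omega)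
    have : (0 : ℝ) ≤ ℓ := by positivity
    linarith
  have h3 : OrdW S (m + 2) (fun β n => 1 / ((n : ℝ) + etaD d) *
      deltaPlus (deltaPlus (g β)) (n - 1)) :=
    fun k => mul_aux hS k 0 (m + 2) _ _ q0 h2
  have h4 := (h2.smul (1 / 2)).add ((h1.add (h3.smul (-1 / 2))).smul (etaD d))
  convert h4 using 3 with β n
  rw [upsilon_eq d hd]
  ring

lemma OrdW.iter (d : ℕ) (hd : 2 ≤ d) (hS : ∀ β i, 0 ≤ S β i) {g : B → ℕ → ℝ}
    (hg : OrdW S 0 g) (N : ℕ) : OrdW S (2 * N) (fun β => (_root_.upsilon d)^[N] (g β)) := by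
  induction N with
  | zero => exact hg
  | succ N ih =>
    have := OrdW.upsilon d hd hS ih
    simp only [Function.iterate_succ_apply']
    exact this

end

lemma dp_smooth (k : ℕ) : ∀ (b : ℝ → ℝ) (M : ℝ), ContDiff ℝ (⊤ : ℕ∞) b →
    (∀ u, |iteratedDeriv k b u| ≤ M) → ∀ ℓ : ℕ,
    |deltaPlus^[k] (fun m : ℕ => b m) ℓ| ≤ M := by
  induction k with
  | zero => intro b M _ h ℓ; simpa using h ℓ
  | succ k ih =>
    intro b M hb h ℓ
    rw [Function.iterate_succ_apply]
    have hb' : ContDiff ℝ (⊤ : ℕ∞) (fun x => b (x + 1)) := hb.comp (contDiff_id.add contDiff_const)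
    have := ih (fun x => b (x + 1) - b x) M (hb'.sub hb) ?_ ℓ
    · convert this using 4 with m
      simp [deltaPlus]
    · intro u
      have e : iteratedDeriv k (fun x => b (x + 1) - b x) u
          = iteratedDeriv k b (u + 1) - iteratedDeriv k b u := by
        have h1 : ContDiffAt ℝ k (fun x => b (x + 1)) u :=
          (hb'.of_le (by exact_mod_cast le_top)).contDiffAt
        have h2 : ContDiffAt ℝ k b u := (hb.of_le (by exact_mod_cast le_top)).contDiffAt
        have := iteratedDeriv_sub h1 h2
        rw [iteratedDeriv_comp_add_const] at this
        exact this
      rw [e]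
      have hd : Differentiable ℝ (iteratedDeriv k b) :=
        hb.differentiable_iteratedDeriv k (by exact_mod_cast ENat.natCast_lt_top k)
      have := Convex.norm_image_sub_le_of_norm_deriv_le (f := iteratedDeriv k b) (s := Set.univ)
        (C := M) (x := u) (y := u + 1) (fun x _ => hd x) (fun x _ => by
          rw [← iteratedDeriv_succ]; exact h x) convex_univ trivial trivial
      simpa using this

/-- **Bound on iterated `Υ_d` applied to a smooth function.**
For every `N` there exist nonnegative constants `C(0), …, C(2N−1)` and `C*`,
depending only on `N` and `d`, such that for every `C^∞` function `b` with all
derivatives bounded and every `ℓ ≥ 1`,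
`|Υ_d^N(ℓ) b| ≤ C* sup_u |b^{(2N)}(u)| + Σ_{i<2N} (C(i)/ℓ^{2N−i}) sup_u |b^{(i)}(u)|`. -/
theorem upsilon_iterate_bound (d : ℕ) (hd : 2 ≤ d) :
    ∀ N : ℕ, ∃ C : ℕ → ℝ, ∃ Cstar : ℝ,
      (∀ i, 0 ≤ C i) ∧ 0 ≤ Cstar ∧
      ∀ b : ℝ → ℝ, ContDiff ℝ (⊤ : ℕ∞) b →
        (∀ n : ℕ, ∃ M : ℝ, ∀ u : ℝ, |iteratedDeriv n b u| ≤ M) →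
        ∀ ℓ : ℕ, 1 ≤ ℓ →
          |((upsilon d)^[N] (fun m : ℕ => b (m : ℝ))) ℓ| ≤
            Cstar * (⨆ u : ℝ, |iteratedDeriv (2 * N) b u|) +
              ∑ i ∈ Finset.range (2 * N),
                (C i / (ℓ : ℝ) ^ (2 * N - i)) * (⨆ u : ℝ, |iteratedDeriv i b u|) := by
  intro N
  let B := {b : ℝ → ℝ // ContDiff ℝ (⊤ : ℕ∞) b ∧
    ∀ n : ℕ, ∃ M : ℝ, ∀ u : ℝ, |iteratedDeriv n b u| ≤ M}
  let S : B → ℕ → ℝ := fun β i => ⨆ u : ℝ, |iteratedDeriv i β.1 u|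
  have hS : ∀ β i, 0 ≤ S β i := fun β i => Real.iSup_nonneg fun u => abs_nonneg _
  have h0 : OrdW S 0 (fun (β : B) (m : ℕ) => β.1 (m : ℝ)) := by
    intro k
    refine ⟨1, zero_le_one, fun β ℓ => ?_⟩
    have h1 : |deltaPlus^[k] (fun m : ℕ => β.1 (m : ℝ)) ℓ| ≤ S β k := by
      apply dp_smooth k β.1 _ β.2.1
      intro u
      obtain ⟨M, hM⟩ := β.2.2 k
      exact le_ciSup (f := fun u : ℝ => |iteratedDeriv k β.1 u|)
        ⟨M, by rintro _ ⟨v, rfl⟩; exact hM v⟩ u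
    rw [one_mul, zero_add]
    refine h1.trans ?_
    have := Finset.single_le_sum (f := fun i => S β i / ((ℓ : ℝ) + 1) ^ (k - i))
      (s := Finset.range (k + 1)) (fun i _ => div_nonneg (hS β i) (by positivity))
      (Finset.mem_range.mpr (Nat.lt_succ_self k))
    simpa [wgt] using this
  obtain ⟨C, hC, h⟩ := OrdW.iter d hd hS h0 N 0
  refine ⟨fun _ => C, C, fun _ => hC, hC, fun b hb hM ℓ hℓ => ?_⟩
  have hbound := h ⟨b, hb, hM⟩ ℓ
  refine hbound.trans ?_
  rw [add_zero, wgt, Finset.sum_range_succ, Nat.sub_self, pow_zero, div_one, mul_add, add_comm]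
  refine add_le_add le_rfl ?_
  rw [Finset.mul_sum]
  apply Finset.sum_le_sum
  intro i _
  have hl : (0 : ℝ) < ℓ := by exact_mod_cast hℓ
  calc C * (S ⟨b, hb, hM⟩ i / ((ℓ : ℝ) + 1) ^ (2 * N - i))
      ≤ C * (S ⟨b, hb, hM⟩ i / (ℓ : ℝ) ^ (2 * N - i)) := by
        apply mul_le_mul_of_nonneg_left _ hC
        apply div_le_div_of_nonneg_left (hS _ i) (by positivity)
        exact pow_le_pow_left₀ hl.le (by linarith) _
    _ = _ := by simp only [S]; ring
end
end
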